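/- arXiv:2107.03152 — 4 statements merged into one kernel-verified Lean document; each statement's English description precedes it below -/
import Mathlib

section
/- Let S be a ballot semistandard skew tableau of shape ν/λ and content μ, and let T_0 be a semistandard tableau of shape λ with entries in the negative integers. Let c_0 be the box of λ occupied by the largest entry of T_0 (the rightmost such box if that entry repeats), let n = |λ| and m = |μ|, and write the biword RSK^{−1}(Y_ν, T_0∪S) = ((t_1,…,t_n,v_1,…,v_m),(x_1,…,x_n,w_1,…,w_m)), where Y_ν is the super-semistandard tableau of shape ν and T_0∪S is the semistandard filling of ν combining T_0 on λ and S on ν/λ. Then demote(c_0) = x_n, where demote(c_0) is the row index of the box added to the content partition when the demotion algorithm is applied to S at the corner c_0. -/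
/-- `f : ℕ → ℕ` is a partition: weakly decreasing and eventually zero
(the parts are `f 0 ≥ f 1 ≥ …`, 0-indexed). -/
def IsPartition (f : ℕ → ℕ) : Prop :=
  (∀ i j, i ≤ j → f j ≤ f i) ∧ ∃ N, ∀ i, N ≤ i → f i = 0

/-- The cell in row `i`, column `j` (0-indexed) lies in the skew shape `ν/λ`. -/
def InSkew (lam nu : ℕ → ℕ) (i j : ℕ) : Prop :=
  lam i ≤ j ∧ j < nu i

/-- `p` is read weakly before `q` in the row reading word of a (skew) tableau:
right to left along rows, top to bottom. -/
def ReadBefore (p q : ℕ × ℕ) : Prop :=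
  p.1 < q.1 ∨ (p.1 = q.1 ∧ q.2 ≤ p.2)

/-- `T` is a Littlewood–Richardson witness for `c^ν_{λ,μ}`: a semistandard skew
tableau of shape `ν/λ` (entries `≥ 1` on the shape, `0` off the shape) with
content `μ`, whose (reverse) row reading word is ballot.  The conditions that
`λ, μ, ν` are partitions with `λ ⊆ ν` are built in, so that the associated
count vanishes on non-partitions. -/
def IsLRTableau (lam mu nu : ℕ → ℕ) (T : ℕ → ℕ → ℕ) : Prop :=
  IsPartition lam ∧ IsPartition mu ∧ IsPartition nu ∧
  (∀ i, lam i ≤ nu i) ∧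
  (∀ i j, ¬ InSkew lam nu i j → T i j = 0) ∧
  (∀ i j, InSkew lam nu i j → 1 ≤ T i j) ∧
  (∀ i j j', InSkew lam nu i j → InSkew lam nu i j' → j ≤ j' → T i j ≤ T i j') ∧
  (∀ i i' j, InSkew lam nu i j → InSkew lam nu i' j → i < i' → T i j < T i' j) ∧
  (∀ k, {p : ℕ × ℕ | InSkew lam nu p.1 p.2 ∧ T p.1 p.2 = k + 1}.ncard = mu k) ∧
  (∀ k, ∀ q : ℕ × ℕ, InSkew lam nu q.1 q.2 → T q.1 q.2 = k + 2 →
    {p : ℕ × ℕ | InSkew lam nu p.1 p.2 ∧ T p.1 p.2 = k + 2 ∧ ReadBefore p q}.ncard ≤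
      {p : ℕ × ℕ | InSkew lam nu p.1 p.2 ∧ T p.1 p.2 = k + 1 ∧ ReadBefore p q}.ncard)

/-- The Littlewood–Richardson coefficient `c^ν_{λ,μ}` (inner shape `λ`,
content `μ`, outer shape `ν`). -/
noncomputable def lrCoeff (lam mu nu : ℕ → ℕ) : ℕ :=
  Nat.card {T : ℕ → ℕ → ℕ // IsLRTableau lam mu nu T}

/-- The Newell–Littlewood number `N_{λ,μ,ν} = ∑ c^λ_{α,β} c^μ_{β,γ} c^ν_{γ,α}`. -/
noncomputable def NL (lam mu nu : ℕ → ℕ) : ℕ :=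
  ∑ᶠ (a : ℕ → ℕ) (b : ℕ → ℕ) (c : ℕ → ℕ),
    lrCoeff a b lam * lrCoeff b c mu * lrCoeff c a nu

/-- Membership in `Par_n`: a partition with at most `n` parts. -/
def MemParN (n : ℕ) (f : ℕ → ℕ) : Prop :=
  IsPartition f ∧ ∀ i, n ≤ i → f i = 0

/-- `|λ_A| = ∑_{i ∈ A} λ_i` for `A ⊆ [n] = {1,…,n}` (1-indexed subset,
0-indexed parts). -/
def sumParts (f : ℕ → ℕ) (A : Finset ℕ) : ℕ := ∑ i ∈ A, f (i - 1)

/-- `|λ| = ∑ λ_i`. -/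
noncomputable def sizeP (f : ℕ → ℕ) : ℕ := ∑ᶠ i, f i
/-- RSK row insertion of a letter into a row: the letter bumps the leftmost
entry strictly greater than it (or is appended at the end of the row). -/
def insertRow : List ℕ → ℕ → List ℕ × Option ℕ
  | [], x => ([x], none)
  | y :: ys, x =>
    if y ≤ x then
      let p := insertRow ys x
      (y :: p.1, p.2)
    else (x :: ys, some y)

/-- RSK row insertion of a letter into a tableau (a list of rows). -/
def insertTab : List (List ℕ) → ℕ → List (List ℕ)
  | [], x => [[x]]
  | row :: rest, x =>
    match insertRow row x with
    | (row', none) => row' :: rest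
    | (row', some y) => row' :: insertTab rest y

/-- The (1-indexed) column index of the box added to the shape when a letter
is row-inserted into a tableau. -/
def insertCol : List (List ℕ) → ℕ → ℕ
  | [], _ => 1
  | row :: rest, x =>
    match insertRow row x with
    | (row', none) => row'.length
    | (_, some y) => insertCol rest y

/-- The (1-indexed) row index of the box added to the shape when a letter
is row-inserted into a tableau. -/
def insertRowIdx : List (List ℕ) → ℕ → ℕ
  | [], _ => 1
  | row :: rest, x =>
    match insertRow row x with
    | (_, none) => 1
    | (_, some y) => insertRowIdx rest y + 1

/-- The RSK insertion tableau of a word: insert its letters in order into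
the empty tableau. -/
def RSK1 (w : List ℕ) : List (List ℕ) := w.foldl insertTab []
/-- Append an entry at the end of the (1-indexed) `r`-th row of a recording
tableau. -/
def placeAt (Q : List (List ℤ)) (r : ℕ) (q : ℤ) : List (List ℤ) :=
  if r - 1 < Q.length then Q.set (r - 1) (Q.getD (r - 1) [] ++ [q]) else Q ++ [[q]]

/-- One step of the RSK correspondence on a biword: row-insert the bottom
letter into the insertion tableau and record the top letter. -/
def RSKstep (PQ : List (List ℕ) × List (List ℤ)) (e : ℤ × ℕ) :
    List (List ℕ) × List (List ℤ) :=
  (insertTab PQ.1 e.2, placeAt PQ.2 (insertRowIdx PQ.1 e.2) e.1)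

/-- The RSK correspondence: the pair (insertion tableau, recording tableau)
of a biword. -/
def RSKpair (bw : List (ℤ × ℕ)) : List (List ℕ) × List (List ℤ) :=
  bw.foldl RSKstep ([], [])
/-- `p` is read strictly before `q` in the column reading order: `p` lies in a
column strictly to the right of `q`, or in the same column strictly above `q`. -/
def ColOrder (p q : ℕ × ℕ) : Prop :=
  q.2 < p.2 ∨ (p.2 = q.2 ∧ p.1 < q.1)

/-- The sequence of boxes `c 0 = c₀, c 1, …, c (m-1)` witnesses the demotion
process on the skew tableau `S` of shape `ν/λ`: for `1 ≤ k < m`, `c k` is the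
first box after `c (k-1)` in the column reading order whose entry is `k`
(this entry is changed into `k+1`), and no box after `c (m-1)` has entry `m`,
so the process terminates with output `m`. -/
def DemotionWitness (lam nu : ℕ → ℕ) (S : ℕ → ℕ → ℕ) (m : ℕ) (c : ℕ → ℕ × ℕ) : Prop :=
  (∀ k, 0 < k → k < m →
    InSkew lam nu (c k).1 (c k).2 ∧ S (c k).1 (c k).2 = k ∧
    ColOrder (c (k - 1)) (c k) ∧
    ∀ p : ℕ × ℕ, InSkew lam nu p.1 p.2 → S p.1 p.2 = k →
      ColOrder (c (k - 1)) p → ¬ ColOrder p (c k)) ∧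
  (∀ p : ℕ × ℕ, InSkew lam nu p.1 p.2 → S p.1 p.2 = m → ¬ ColOrder (c (m - 1)) p)

/-- The demotion algorithm applied to the skew tableau `S` of shape `ν/λ` at
the corner box `c₀` of `λ` terminates with `demote(c₀) = m` (the row index of
the box added to the content). -/
def IsDemotion (lam nu : ℕ → ℕ) (S : ℕ → ℕ → ℕ) (c0 : ℕ × ℕ) (m : ℕ) : Prop :=
  0 < m ∧ ∃ c : ℕ → ℕ × ℕ, c 0 = c0 ∧ DemotionWitness lam nu S m c

/-- The demotion algorithm applied to `S` at the corner box `c₀` terminates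
with `demote(c₀) = m` and output tableau `S'` (which has entry `k+1` in box
`c k` for `0 ≤ k < m`, and agrees with `S` elsewhere). -/
def IsDemotionPair (lam nu : ℕ → ℕ) (S : ℕ → ℕ → ℕ) (c0 : ℕ × ℕ) (m : ℕ)
    (S' : ℕ → ℕ → ℕ) : Prop :=
  0 < m ∧ ∃ c : ℕ → ℕ × ℕ, c 0 = c0 ∧ DemotionWitness lam nu S m c ∧
    (∀ k, k < m → S' (c k).1 (c k).2 = k + 1) ∧
    (∀ p : ℕ × ℕ, (∀ k, k < m → p ≠ c k) → S' p.1 p.2 = S p.1 p.2)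



structure Kn {M : Type*} [Monoid M] (f : ℕ → M) : Prop where
  h1 : ∀ x y z, x < y → y ≤ z → f y * f x * f z = f y * f z * f x
  h2 : ∀ x y z, x ≤ y → y < z → f x * f z * f y = f z * f x * f y

def pw {M : Type*} [Monoid M] (f : ℕ → M) (l : List ℕ) : M := (l.map f).prod

theorem pw_nil {M : Type*} [Monoid M] (f : ℕ → M) : pw f [] = 1 := by simp [pw]
theorem pw_cons {M : Type*} [Monoid M] (f : ℕ → M) (a l) : pw f (a :: l) = f a * pw f l := by
  simp [pw]
theorem pw_append {M : Type*} [Monoid M] (f : ℕ → M) (a l) :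
    pw f (a ++ l) = pw f a * pw f l := by simp [pw]

abbrev Srt (l : List ℕ) : Prop := l.Pairwise (· ≤ ·)

theorem pw_move {M : Type*} [Monoid M] {f : ℕ → M} (hf : Kn f) (x : ℕ) (l : List ℕ) :
    ∀ y, x < y → Srt (y :: l) → f y * pw f l * f x = f y * f x * pw f l := by
  induction l with
  | nil => intro y _ _; simp [pw_nil]
  | cons z zs ih =>
    intro y hxy hs
    rw [Srt, List.pairwise_cons] at hs
    have hyz := hs.1 z (by simp)
    have := ih z (lt_of_lt_of_le hxy hyz) hs.2
    rw [pw_cons, mul_assoc (f y), this, ← mul_assoc, ← mul_assoc, ← mul_assoc, hf.h1 x y z hxy hyz]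

theorem insertRow_none {a : List ℕ} {x : ℕ} {a' : List ℕ} (h : insertRow a x = (a', none)) :
    a' = a ++ [x] ∧ ∀ b ∈ a, b ≤ x := by
  induction a generalizing a' with
  | nil => simp [insertRow] at h; simp [h]
  | cons y ys ih =>
    by_cases hy : y ≤ x
    · simp only [insertRow, hy, if_true, Prod.mk.injEq] at h
      obtain ⟨h1, h2⟩ := h
      have := ih (a' := (insertRow ys x).1) (by rw [← h2])
      rw [← h1, this.1]
      exact ⟨rfl, by simpa [hy] using this.2⟩
    · simp [insertRow, hy] at h

/-- structure of a bump -/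
theorem insertRow_some {a : List ℕ} {x z : ℕ} {a' : List ℕ} (h : insertRow a x = (a', some z)) :
    ∃ l r, a = l ++ z :: r ∧ a' = l ++ x :: r ∧ x < z ∧ ∀ b ∈ l, b ≤ x := by
  induction a generalizing a' with
  | nil => simp [insertRow] at h
  | cons y ys ih =>
    by_cases hy : y ≤ x
    · simp only [insertRow, hy, if_true, Prod.mk.injEq] at h
      obtain ⟨h1, h2⟩ := h
      obtain ⟨l, r, e1, e2, e3, e4⟩ := ih (a' := (insertRow ys x).1) (by rw [← h2])
      refine ⟨y :: l, r, by simp [e1], by rw [← h1, e2]; simp, e3, by simpa [hy] using e4⟩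
    · simp [insertRow, hy] at h
      exact ⟨[], ys, by simp [h.2], by simp [h.1], by omega, by simp⟩

theorem insertRow_srt_none {a : List ℕ} {x : ℕ} {a' : List ℕ} (h : insertRow a x = (a', none))
    (hs : Srt a) : Srt a' := by
  obtain ⟨rfl, h2⟩ := insertRow_none h
  simp only [Srt, List.pairwise_append]
  exact ⟨hs, by simp, by simpa using h2⟩

theorem insertRow_srt_some {a : List ℕ} {x z : ℕ} {a' : List ℕ}
    (h : insertRow a x = (a', some z)) (hs : Srt a) : Srt a' := by
  obtain ⟨l, r, rfl, rfl, h3, h4⟩ := insertRow_some h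
  simp only [Srt, List.pairwise_append, List.pairwise_cons, List.mem_cons] at *
  grind

theorem insertRow_srt {a : List ℕ} {x : ℕ} (hs : Srt a) : Srt (insertRow a x).1 := by
  rcases h : insertRow a x with ⟨a', _ | z⟩
  · exact insertRow_srt_none h hs
  · exact insertRow_srt_some h hs

theorem pw_pass {M : Type*} [Monoid M] {f : ℕ → M} (hf : Kn f) (x z : ℕ) (r l : List ℕ) 
    (hxz : x < z) (hl : Srt l) (hlx : ∀ b ∈ l, b ≤ x) :
    pw f l * f z * f x * pw f r = f z * pw f (l ++ x :: r) := by
  induction l with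
  | nil => simp [pw_nil, pw_cons, mul_assoc]
  | cons y ys ih =>
    rw [Srt, List.pairwise_cons] at hl
    have ih := ih hl.2 (fun b hb => hlx b (by simp [hb]))
    rw [pw_cons, mul_assoc (f y), mul_assoc (f y), mul_assoc (f y), ih, List.cons_append, pw_cons]
    obtain ⟨h, t, e, h1, h2⟩ : ∃ h t, ys ++ x :: r = h :: t ∧ y ≤ h ∧ h < z := by
      rcases ys with _ | ⟨h, t⟩
      · exact ⟨x, r, rfl, hlx y (by simp), hxz⟩
      · exact ⟨h, t ++ x :: r, rfl, hl.1 h (by simp), lt_of_le_of_lt (hlx h (by simp)) hxz⟩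
    rw [e, pw_cons, ← mul_assoc, ← mul_assoc, ← mul_assoc, ← mul_assoc, hf.h2 y h z h1 h2]

theorem pw_insert_some {M : Type*} [Monoid M] {f : ℕ → M} (hf : Kn f) {a : List ℕ} {x z : ℕ}
    {a' : List ℕ} (h : insertRow a x = (a', some z)) (hs : Srt a) :
    pw f a * f x = f z * pw f a' := by
  obtain ⟨l, r, rfl, rfl, h3, h4⟩ := insertRow_some h
  have hs' := List.pairwise_append.1 hs
  rw [pw_append, pw_cons, mul_assoc, pw_move hf x r z h3 hs'.2.1, ← mul_assoc, ← mul_assoc,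
    pw_pass hf x z r l h3 hs'.1 h4]

theorem pw_insert_none {M : Type*} [Monoid M] {f : ℕ → M} {a : List ℕ} {x : ℕ}
    {a' : List ℕ} (h : insertRow a x = (a', none)) :
    pw f a * f x = pw f a' := by
  obtain ⟨rfl, h4⟩ := insertRow_none h
  simp [pw_append, pw_cons, pw_nil]

/-! P side -/
def wordP {M : Type*} [Monoid M] (f : ℕ → M) : List (List ℕ) → M
  | [] => 1
  | row :: rest => wordP f rest * pw f row

def RowsSrt (P : List (List ℕ)) : Prop := ∀ r ∈ P, Srt r

theorem insertTab_srt (P : List (List ℕ)) : ∀ x, RowsSrt P → RowsSrt (insertTab P x) := by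
  induction P with
  | nil => intro x _; simp [insertTab, RowsSrt]
  | cons row rest ih =>
    intro x h
    simp only [RowsSrt, List.mem_cons, forall_eq_or_imp] at h
    rcases hi : insertRow row x with ⟨a', _ | z⟩
    · simp only [insertTab, hi, RowsSrt, List.mem_cons, forall_eq_or_imp]
      exact ⟨insertRow_srt_none hi h.1, h.2⟩
    · simp only [insertTab, hi, RowsSrt, List.mem_cons, forall_eq_or_imp]
      exact ⟨insertRow_srt_some hi h.1, ih z h.2⟩

theorem wordP_insert {M : Type*} [Monoid M] {f : ℕ → M} (hf : Kn f) (P : List (List ℕ)) :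
    ∀ x, RowsSrt P → wordP f (insertTab P x) = wordP f P * f x := by
  induction P with
  | nil => intro x _; simp [insertTab, wordP, pw_cons, pw_nil]
  | cons row rest ih =>
    intro x h
    simp only [RowsSrt, List.mem_cons, forall_eq_or_imp] at h
    rcases hi : insertRow row x with ⟨a', _ | z⟩
    · simp only [insertTab, hi, wordP, mul_assoc, pw_insert_none hi]
    · simp only [insertTab, hi, wordP, mul_assoc, pw_insert_some hf hi h.1, ih z h.2]

theorem wordP_foldl {M : Type*} [Monoid M] {f : ℕ → M} (hf : Kn f) (w : List ℕ) :
    ∀ P, RowsSrt P → wordP f (w.foldl insertTab P) = wordP f P * pw f w := by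
  induction w with
  | nil => intro P _; simp [pw_nil]
  | cons x w ih =>
    intro P h
    rw [List.foldl_cons, ih _ (insertTab_srt P x h), wordP_insert hf P x h, pw_cons, mul_assoc]

theorem foldl_srt (w : List ℕ) :
    ∀ P, RowsSrt P → RowsSrt (w.foldl insertTab P) := by
  induction w with
  | nil => intro P h; simpa using h
  | cons x w ih =>
    intro P h
    exact ih _ (insertTab_srt P x h)

/-- tie lemma -/
theorem rowIdx_tie (P : List (List ℕ)) : ∀ x y, RowsSrt P → x ≤ y →
    insertRowIdx (insertTab P x) y ≤ insertRowIdx P x := by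
  induction P with
  | nil => intro x y _ h; simp [insertTab, insertRowIdx, insertRow, h]
  | cons row rest ih =>
    intro x y h hxy
    simp only [RowsSrt, List.mem_cons, forall_eq_or_imp] at h
    rcases hi : insertRow row x with ⟨a', _ | z⟩
    · simp only [insertTab, hi, insertRowIdx]
      rcases hj : insertRow a' y with ⟨a'', _ | w⟩
      · simp
      · exfalso
        obtain ⟨rfl, h2⟩ := insertRow_none hi
        obtain ⟨l, r, e1, e2, e3, e4⟩ := insertRow_some hj
        have : w ∈ row ++ [x] := by simp [e1]
        grind
    · simp only [insertTab, hi, insertRowIdx]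
      rcases hj : insertRow a' y with ⟨a'', _ | w⟩
      · simp
      · simp only [add_le_add_iff_right]
        apply ih z w h.2
        obtain ⟨l, r, rfl, rfl, e3, e4⟩ := insertRow_some hi
        obtain ⟨l', r', f1, f2, f3, f4⟩ := insertRow_some hj
        have : w ∈ l ++ x :: r := by simp [f1]
        have h1 := h.1
        simp only [Srt, List.pairwise_append, List.pairwise_cons, List.mem_cons] at *
        grind

theorem rowIdx_tie' (ys : List ℕ) : ∀ (P : List (List ℕ)) (y x : ℕ), RowsSrt P →
    Srt (y :: (ys ++ [x])) →
    insertRowIdx (ys.foldl insertTab (insertTab P y)) x ≤ insertRowIdx P y := by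
  induction ys with
  | nil => intro P y x hP h; exact rowIdx_tie P y x hP (by simpa using h)
  | cons z zs ih =>
    intro P y x hP h
    rw [List.cons_append, Srt, List.pairwise_cons] at h
    exact (ih (insertTab P y) z x (insertTab_srt P y hP) h.2).trans
      (rowIdx_tie P y z hP (h.1 z (by simp)))
/-! Q side -/
def bumpB {τ : Type*} : List ℕ → List (τ × ℕ) → List (τ × ℕ)
  | _, [] => []
  | ρ, e :: β =>
    match insertRow ρ e.2 with
    | (ρ', none) => bumpB ρ' β
    | (ρ', some y) => (e.1, y) :: bumpB ρ' β

def appB {τ : Type*} : List ℕ → List (τ × ℕ) → List τ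
  | _, [] => []
  | ρ, e :: β =>
    match insertRow ρ e.2 with
    | (ρ', none) => e.1 :: appB ρ' β
    | (ρ', some _) => appB ρ' β

def recRow {τ : Type*} : List (List ℕ) → List (τ × ℕ) → ℕ → List τ
  | _, [], _ => []
  | P, e :: β, i =>
    if insertRowIdx P e.2 = i + 1 then e.1 :: recRow (insertTab P e.2) β i
    else recRow (insertTab P e.2) β i

theorem insertRowIdx_pos (P : List (List ℕ)) (x : ℕ) : 1 ≤ insertRowIdx P x := by
  cases P with
  | nil => simp [insertRowIdx]
  | cons row rest =>
    simp only [insertRowIdx]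
    split <;> omega

theorem recRow_zero {τ : Type*} (β : List (τ × ℕ)) : ∀ ρ rest,
    recRow (ρ :: rest) β 0 = appB ρ β := by
  induction β with
  | nil => intro ρ rest; simp [recRow, appB]
  | cons e β ih =>
    intro ρ rest
    rcases hi : insertRow ρ e.2 with ⟨a', _ | z⟩
    · simp [recRow, appB, insertRowIdx, insertTab, hi, ih]
    · have := insertRowIdx_pos rest z
      simp only [recRow, appB, insertRowIdx, insertTab, hi, ih]
      rw [if_neg (by omega)]

theorem recRow_succ {τ : Type*} (β : List (τ × ℕ)) (i : ℕ) : ∀ ρ rest,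
    recRow (ρ :: rest) β (i + 1) = recRow rest (bumpB ρ β) i := by
  induction β with
  | nil => intro ρ rest; simp [recRow, bumpB]
  | cons e β ih =>
    intro ρ rest
    rcases hi : insertRow ρ e.2 with ⟨a', _ | z⟩
    · simp [recRow, bumpB, insertRowIdx, insertTab, hi, ih]
    · simp [recRow, bumpB, insertRowIdx, insertTab, hi, ih]

theorem recRow_nil {τ : Type*} (β : List (τ × ℕ)) (i : ℕ) :
    recRow [] β i = recRow [[]] β i := by
  cases β with
  | nil => simp [recRow]
  | cons e β => simp [recRow, insertRowIdx, insertTab, insertRow]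

theorem recRow_append {τ : Type*} (β γ : List (τ × ℕ)) (i : ℕ) : ∀ P,
    recRow P (β ++ γ) i = recRow P β i ++ recRow ((β.map Prod.snd).foldl insertTab P) γ i := by
  induction β with
  | nil => intro P; simp [recRow]
  | cons e β ih =>
    intro P
    simp only [List.cons_append, recRow, List.map_cons, List.foldl_cons, ih]
    split <;> simp

theorem recRow_map {τ τ' : Type*} (g : τ → τ') (β : List (τ × ℕ)) (i : ℕ) : ∀ P,
    recRow P (β.map fun e => (g e.1, e.2)) i = (recRow P β i).map g := by
  induction β with
  | nil => intro P; simp [recRow]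
  | cons e β ih =>
    intro P
    simp only [recRow, List.map_cons, ih]
    split <;> simp

theorem recRow_mem {τ : Type*} (β : List (τ × ℕ)) (i : ℕ) : ∀ P, ∀ t ∈ recRow P β i,
    ∃ x, (t, x) ∈ β := by
  induction β with
  | nil => intro P; simp [recRow]
  | cons e β ih =>
    intro P t ht
    simp only [recRow] at ht
    split at ht
    · rcases List.mem_cons.1 ht with rfl | ht
      · exact ⟨e.2, by simp⟩
      · obtain ⟨x, hx⟩ := ih _ _ ht
        exact ⟨x, by simp [hx]⟩
    · obtain ⟨x, hx⟩ := ih _ _ ht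
      exact ⟨x, by simp [hx]⟩

theorem recRow_length {τ : Type*} (N : ℕ) (β : List (τ × ℕ)) : ∀ P,
    (∀ i, N ≤ i → recRow P β i = []) →
    ∑ i ∈ Finset.range N, (recRow P β i).length = β.length := by
  induction β with
  | nil => intro P; simp [recRow]
  | cons e β ih =>
    intro P h
    have h1 := insertRowIdx_pos P e.2
    have hlt : insertRowIdx P e.2 - 1 < N := by
      by_contra hc
      have := h (insertRowIdx P e.2 - 1) (by omega)
      simp only [recRow] at this
      rw [if_pos (by omega)] at this
      simp at this
    have := ih (insertTab P e.2) (by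
      intro i hi
      have := h i hi
      simp only [recRow] at this
      split at this
      · simp at this
      · exact this)
    rw [List.length_cons, ← this]
    have : ∀ i ∈ Finset.range N, (recRow P (e :: β) i).length =
        (recRow (insertTab P e.2) β i).length + if i = insertRowIdx P e.2 - 1 then 1 else 0 := by
      intro i _
      simp only [recRow]
      by_cases hi : insertRowIdx P e.2 = i + 1
      · rw [if_pos hi, if_pos (by omega)]; simp
      · rw [if_neg hi, if_neg (by omega)]; simp
    rw [Finset.sum_congr rfl this, Finset.sum_add_distrib]
    simp [hlt]

abbrev BSrt (β : List (ℕ × ℕ)) : Prop :=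
  β.Pairwise (fun a b => a.1 < b.1 ∨ (a.1 = b.1 ∧ a.2 ≤ b.2))

theorem bumpB_tops (β : List (ℕ × ℕ)) : ∀ ρ, ∀ e ∈ bumpB ρ β, ∃ e' ∈ β, e'.1 = e.1 := by
  induction β with
  | nil => intro ρ; simp [bumpB]
  | cons e β ih =>
    intro ρ
    rcases hi : insertRow ρ e.2 with ⟨a', _ | z⟩
    · simp only [bumpB, hi]
      intro e1 he1
      obtain ⟨e', h1, h2⟩ := ih _ _ he1
      exact ⟨e', by simp [h1], h2⟩
    · simp only [bumpB, hi]
      intro e1 he1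
      rcases List.mem_cons.1 he1 with rfl | he1
      · exact ⟨e, by simp, rfl⟩
      obtain ⟨e', h1, h2⟩ := ih _ _ he1
      exact ⟨e', by simp [h1], h2⟩

theorem bumpB_bound (B : ℕ) (β : List (ℕ × ℕ)) : ∀ ρ, (∀ a ∈ ρ, a < B) → (∀ e ∈ β, e.2 < B) →
    ∀ e ∈ bumpB ρ β, e.2 < B := by
  induction β with
  | nil => intro ρ; simp [bumpB]
  | cons e β ih =>
    intro ρ hρ hβ
    simp only [List.mem_cons, forall_eq_or_imp] at hβ
    rcases hi : insertRow ρ e.2 with ⟨a', _ | z⟩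
    · simp only [bumpB, hi]
      obtain ⟨rfl, h2⟩ := insertRow_none hi
      exact ih _ (by simpa [or_imp, forall_and, hβ.1] using hρ) hβ.2
    · simp only [bumpB, hi, List.mem_cons, forall_eq_or_imp]
      obtain ⟨l, r, rfl, rfl, e3, e4⟩ := insertRow_some hi
      refine ⟨hρ z (by simp), ih _ ?_ hβ.2⟩
      intro a ha
      simp only [List.mem_append, List.mem_cons] at ha hρ
      grind

theorem bumpB_tie (t z : ℕ) (β : List (ℕ × ℕ)) : ∀ (ρ : List ℕ) (y : ℕ), 
    (∀ a ∈ ρ, y < a → z ≤ a) → BSrt β → (∀ e ∈ β, t < e.1 ∨ (t = e.1 ∧ y ≤ e.2)) →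
    ∀ e ∈ bumpB ρ β, t < e.1 ∨ (t = e.1 ∧ z ≤ e.2) := by
  induction β with
  | nil => intro ρ y; simp [bumpB]
  | cons e β ih =>
    intro ρ y hinv hs hβ e1 he1
    rw [BSrt, List.pairwise_cons] at hs
    simp only [List.mem_cons, forall_eq_or_imp] at hβ
    rcases hβ.1 with hlt | ⟨heq, hle⟩
    · obtain ⟨e', h1, h2⟩ := bumpB_tops _ _ _ he1
      left
      rw [← h2]
      rcases List.mem_cons.1 h1 with rfl | h1
      · exact hlt
      · have := hs.1 e' h1
        omega
    · have key : ∀ e' ∈ β, t < e'.1 ∨ (t = e'.1 ∧ e.2 ≤ e'.2) := by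
        intro e' h'
        have := hs.1 e' h'
        omega
      rcases hi : insertRow ρ e.2 with ⟨a', _ | w⟩
      · simp only [bumpB, hi] at he1
        obtain ⟨rfl, h2⟩ := insertRow_none hi
        refine ih _ e.2 ?_ hs.2 key _ he1
        intro a ha hea
        simp only [List.mem_append, List.mem_singleton] at ha
        rcases ha with ha | rfl
        · exact hinv a ha (by omega)
        · omega
      · simp only [bumpB, hi] at he1
        obtain ⟨l, r, rfl, rfl, e3, e4⟩ := insertRow_some hi
        rcases List.mem_cons.1 he1 with rfl | he1
        · right
          exact ⟨heq, hinv w (by simp) (by omega)⟩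
        refine ih _ e.2 ?_ hs.2 key _ he1
        intro a ha hea
        simp only [List.mem_append, List.mem_cons] at ha hinv
        grind

theorem bumpB_srt (β : List (ℕ × ℕ)) : ∀ ρ, Srt ρ → BSrt β → BSrt (bumpB ρ β) := by
  induction β with
  | nil => intro ρ; simp [bumpB]
  | cons e β ih =>
    intro ρ hρ hs
    rw [BSrt, List.pairwise_cons] at hs
    rcases hi : insertRow ρ e.2 with ⟨a', _ | w⟩
    · simp only [bumpB, hi]
      exact ih _ (insertRow_srt_none hi hρ) hs.2
    · simp only [bumpB, hi]
      rw [BSrt, List.pairwise_cons]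
      refine ⟨?_, ih _ (insertRow_srt_some hi hρ) hs.2⟩
      obtain ⟨l, r, rfl, rfl, e3, e4⟩ := insertRow_some hi
      apply bumpB_tie e.1 w β _ e.2 _ hs.2 hs.1
      intro a ha hea
      simp only [Srt, List.pairwise_append, List.pairwise_cons, List.mem_append, List.mem_cons] at *
      grind

/-- multi insertion into a row -/
def insL : List ℕ → List ℕ → List ℕ × List ℕ
  | a, [] => (a, [])
  | a, x :: b =>
    match insertRow a x with
    | (a', none) => insL a' b
    | (a', some z) => ((insL a' b).1, z :: (insL a' b).2)

theorem pw_insL {M : Type*} [Monoid M] {f : ℕ → M} (hf : Kn f) (b : List ℕ) : ∀ a, Srt a →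
    pw f a * pw f b = pw f (insL a b).2 * pw f (insL a b).1 := by
  induction b with
  | nil => intro a _; simp [insL, pw_nil]
  | cons x b ih =>
    intro a ha
    rcases hi : insertRow a x with ⟨a', _ | z⟩
    · simp only [insL, hi]
      rw [← ih _ (insertRow_srt_none hi ha), ← pw_insert_none hi, pw_cons, mul_assoc]
    · simp only [insL, hi]
      rw [pw_cons, pw_cons, mul_assoc, ← ih _ (insertRow_srt_some hi ha), ← mul_assoc, ← mul_assoc,
        pw_insert_some hf hi ha]

theorem insL_skip (t : ℕ) (b : List ℕ) : ∀ a, (∀ x ∈ b, t ≤ x) →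
    insL (t :: a) b = (t :: (insL a b).1, (insL a b).2) := by
  induction b with
  | nil => intro a _; simp [insL]
  | cons x b ih =>
    intro a h
    simp only [List.mem_cons, forall_eq_or_imp] at h
    rcases hi : insertRow a x with ⟨a', _ | z⟩
    · simp [insL, insertRow, hi, h.1, ih _ h.2]
    · simp [insL, insertRow, hi, h.1, ih _ h.2]

/-- tops at which the number of entries `< x` of the row increases -/
def sx (x : ℕ) : List ℕ → List (ℕ × ℕ) → List ℕ
  | _, [] => []
  | ρ, e :: β =>
    match insertRow ρ e.2 with
    | (ρ', none) => if e.2 < x then e.1 :: sx x ρ' β else sx x ρ' β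
    | (ρ', some z) => if e.2 < x ∧ x ≤ z then e.1 :: sx x ρ' β else sx x ρ' β

def blk (x : ℕ) (β : List (ℕ × ℕ)) : List ℕ := (β.filter (fun e => e.2 = x)).map Prod.fst

theorem blk_cons (x : ℕ) (e : ℕ × ℕ) (β) : 
    blk x (e :: β) = if e.2 = x then e.1 :: blk x β else blk x β := by
  simp only [blk, List.filter_cons]
  split <;> simp_all

theorem mem_blk {x t : ℕ} {β : List (ℕ × ℕ)} : t ∈ blk x β ↔ (t, x) ∈ β := by
  simp [blk]

theorem sx_mem (x : ℕ) (β : List (ℕ × ℕ)) : ∀ ρ, ∀ t ∈ sx x ρ β, ∃ y < x, (t, y) ∈ β := by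
  induction β with
  | nil => intro ρ; simp [sx]
  | cons e β ih =>
    intro ρ t ht
    rcases hi : insertRow ρ e.2 with ⟨a', _ | z⟩ <;> simp only [sx, hi] at ht <;> split at ht
    · rcases List.mem_cons.1 ht with rfl | ht
      · exact ⟨e.2, by assumption, by simp⟩
      · obtain ⟨y, h1, h2⟩ := ih _ _ ht; exact ⟨y, h1, by simp [h2]⟩
    · obtain ⟨y, h1, h2⟩ := ih _ _ ht; exact ⟨y, h1, by simp [h2]⟩
    · rcases List.mem_cons.1 ht with rfl | ht
      · exact ⟨e.2, by tauto, by simp⟩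
      · obtain ⟨y, h1, h2⟩ := ih _ _ ht; exact ⟨y, h1, by simp [h2]⟩
    · obtain ⟨y, h1, h2⟩ := ih _ _ ht; exact ⟨y, h1, by simp [h2]⟩

theorem sx_srt (x : ℕ) (β : List (ℕ × ℕ)) : ∀ ρ, BSrt β → Srt (sx x ρ β) := by
  induction β with
  | nil => intro ρ; simp [sx]
  | cons e β ih =>
    intro ρ hs
    rw [BSrt, List.pairwise_cons] at hs
    have key : ∀ ρ', Srt (e.1 :: sx x ρ' β) := by
      intro ρ'
      rw [Srt, List.pairwise_cons]
      refine ⟨?_, ih _ hs.2⟩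
      intro t ht
      obtain ⟨y, h1, h2⟩ := sx_mem _ _ _ _ ht
      have := hs.1 _ h2
      omega
    rcases hi : insertRow ρ e.2 with ⟨a', _ | z⟩ <;> simp only [sx, hi] <;> split
    · exact key _
    · exact ih _ hs.2
    · exact key _
    · exact ih _ hs.2

theorem sx_zero (β : List (ℕ × ℕ)) : ∀ ρ, sx 0 ρ β = [] := by
  induction β with
  | nil => intro ρ; simp [sx]
  | cons e β ih =>
    intro ρ
    rcases hi : insertRow ρ e.2 with ⟨a', _ | z⟩ <;> simp [sx, hi, ih]

theorem sx_top (B : ℕ) (β : List (ℕ × ℕ)) : ∀ ρ, (∀ a ∈ ρ, a < B) → (∀ e ∈ β, e.2 < B) →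
    sx B ρ β = appB ρ β := by
  induction β with
  | nil => intro ρ; simp [sx, appB]
  | cons e β ih =>
    intro ρ hρ hβ
    simp only [List.mem_cons, forall_eq_or_imp] at hβ
    rcases hi : insertRow ρ e.2 with ⟨a', _ | z⟩
    · simp only [sx, appB, hi, hβ.1, if_true]
      obtain ⟨rfl, h2⟩ := insertRow_none hi
      rw [ih _ (by simpa [or_imp, forall_and, hβ.1] using hρ) hβ.2]
    · simp only [sx, appB, hi]
      obtain ⟨l, r, rfl, rfl, e3, e4⟩ := insertRow_some hi
      have := hρ z (by simp)
      rw [if_neg (by omega), ih _ ?_ hβ.2]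
      intro a ha
      simp only [List.mem_append, List.mem_cons] at ha hρ
      grind

theorem queue_lemma (x : ℕ) (β : List (ℕ × ℕ)) : ∀ ρ, Srt ρ → BSrt β →
    blk x (bumpB ρ β) = (sx x ρ β).take (ρ.count x) ++
      (insL ((sx x ρ β).drop (ρ.count x)) (blk x β)).2 ∧
    sx (x + 1) ρ β = (insL ((sx x ρ β).drop (ρ.count x)) (blk x β)).1 := by
  induction β with
  | nil => intro ρ; simp [sx, bumpB, blk, insL]
  | cons e β ih =>
    intro ρ hρ hs
    rw [BSrt, List.pairwise_cons] at hs
    have hb : ∀ t ∈ blk x β, e.1 ≤ t := by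
      intro t ht
      have := hs.1 _ (mem_blk.1 ht)
      omega
    have hB : e.2 = x → ∀ ρ', ∀ t ∈ sx x ρ' β, e.1 < t := by
      intro h ρ' t ht
      obtain ⟨y, h1, h2⟩ := sx_mem _ _ _ _ ht
      have := hs.1 _ h2
      omega
    have hBins : e.2 = x → ∀ ρ' k, 
        (insL ((sx x ρ' β).drop k) (e.1 :: blk x β)) = 
        (e.1 :: (insL ((sx x ρ' β).drop (k+1)) (blk x β)).1,
          ((sx x ρ' β).drop k).take 1 ++ (insL ((sx x ρ' β).drop (k+1)) (blk x β)).2) := by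
      intro h ρ' k
      rw [← List.drop_drop]
      have : ∀ t ∈ (sx x ρ' β).drop k, e.1 < t := fun t ht => hB h ρ' t (List.mem_of_mem_drop ht)
      generalize (sx x ρ' β).drop k = d at this ⊢
      rcases d with _ | ⟨s, a⟩
      · simp [insL, insertRow, insL_skip _ _ _ hb]
      · have h1 := this s (by simp)
        simp [insL, insertRow, insL_skip _ _ _ hb, not_le.2 h1]
    rcases hi : insertRow ρ e.2 with ⟨a', _ | z⟩
    · have IH := ih a' (insertRow_srt_none hi hρ) hs.2
      obtain ⟨rfl, h2⟩ := insertRow_none hi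
      rcases lt_trichotomy e.2 x with hlt | heq | hgt
      · have hc : ρ.count x = 0 := by
          rw [List.count_eq_zero]; intro hm; have := h2 x hm; omega
        have hc' : (ρ ++ [e.2]).count x = 0 := by
          rw [List.count_append, hc, List.count_eq_zero.2]; simp; omega
        simp only [hc', List.take_zero, List.drop_zero, List.nil_append] at IH
        simp only [sx, bumpB, hi, blk_cons, hlt, if_true, if_neg hlt.ne, hc, IH, List.take_zero,
          List.drop_zero, List.nil_append, if_pos (show e.2 < x + 1 by omega)]
        rw [insL_skip _ _ _ hb]
        simp
      · have hc' : (ρ ++ [e.2]).count x = ρ.count x + 1 := by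
          rw [List.count_append, heq]; simp
        rw [hc'] at IH
        simp only [sx, bumpB, hi, blk_cons, if_pos heq, if_neg (show ¬ e.2 < x by omega), IH,
          if_pos (show e.2 < x + 1 by omega), hBins heq, and_true]
        rw [← List.append_assoc, List.take_add]
      · have hc' : (ρ ++ [e.2]).count x = ρ.count x := by
          rw [List.count_append, List.count_eq_zero.2 (by simp; omega : x ∉ [e.2])]; simp
        rw [hc'] at IH
        simp only [sx, bumpB, hi, blk_cons, if_neg hgt.ne', if_neg (show ¬ e.2 < x by omega), IH,
          if_neg (show ¬ e.2 < x + 1 by omega), and_self]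
    · have IH := ih a' (insertRow_srt_some hi hρ) hs.2
      obtain ⟨l, r, rfl, rfl, h3, h4⟩ := insertRow_some hi
      have hzr : ∀ b ∈ r, z ≤ b := by
        simp only [Srt, List.pairwise_append, List.pairwise_cons] at hρ
        exact hρ.2.1.1
      rw [List.count_append, List.count_cons] at IH ⊢
      rcases lt_trichotomy e.2 x with hlt | heq | hgt
      · have hl : l.count x = 0 := by
          rw [List.count_eq_zero]; intro hm; have := h4 x hm; omega
        rcases lt_trichotomy z x with hz | hz | hz
        · simp only [beq_iff_eq, hlt.ne, hz.ne, if_false, add_zero] at IH ⊢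
          simp only [sx, bumpB, hi, blk_cons, if_neg hz.ne, if_neg hlt.ne, IH,
            if_neg (show ¬ (e.2 < x ∧ x ≤ z) by omega), 
            if_neg (show ¬ (e.2 < x + 1 ∧ x + 1 ≤ z) by omega), and_self]
        · subst hz
          simp only [beq_iff_eq, hlt.ne, if_false, if_true, add_zero, hl, zero_add] at IH ⊢
          simp only [sx, bumpB, hi, blk_cons, if_neg hlt.ne, IH, if_true, hlt, le_refl, and_self,
            if_neg (show ¬ (e.2 < z + 1 ∧ z + 1 ≤ z) by omega)]
          simp
        · have hr : r.count x = 0 := by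
            rw [List.count_eq_zero]; intro hm; have := hzr x hm; omega
          simp only [beq_iff_eq, hlt.ne, hz.ne', if_false, add_zero, hl, hr, List.take_zero,
            List.drop_zero, List.nil_append] at IH ⊢
          simp only [sx, bumpB, hi, blk_cons, if_neg hz.ne', if_neg hlt.ne, IH,
            if_pos (show (e.2 < x ∧ x ≤ z) by omega), 
            if_pos (show (e.2 < x + 1 ∧ x + 1 ≤ z) by omega)]
          rw [insL_skip _ _ _ hb]
          simp
      · have hz : z ≠ x := by omega
        simp only [beq_iff_eq, if_pos heq, hz, if_false, add_zero] at IH ⊢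
        rw [← add_assoc] at IH
        simp only [sx, bumpB, hi, blk_cons, if_neg hz, if_pos heq, IH,
            if_neg (show ¬ (e.2 < x ∧ x ≤ z) by omega), hBins heq,
            if_pos (show (e.2 < x + 1 ∧ x + 1 ≤ z) by omega), and_true]
        rw [← List.append_assoc, ← List.take_add]
      · have hz : z ≠ x := by omega
        simp only [beq_iff_eq, hgt.ne', hz, if_false, add_zero] at IH ⊢
        simp only [sx, bumpB, hi, blk_cons, if_neg hz, if_neg hgt.ne', IH,
            if_neg (show ¬ (e.2 < x ∧ x ≤ z) by omega), 
            if_neg (show ¬ (e.2 < x + 1 ∧ x + 1 ≤ z) by omega), and_self]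

theorem pw_local {M : Type*} [Monoid M] {f : ℕ → M} (hf : Kn f) (x : ℕ) (ρ : List ℕ)
    (β : List (ℕ × ℕ)) (hρ : Srt ρ) (hβ : BSrt β) :
    pw f (sx x ρ β) * pw f (blk x β) = pw f (blk x (bumpB ρ β)) * pw f (sx (x + 1) ρ β) := by
  obtain ⟨h1, h2⟩ := queue_lemma x β ρ hρ hβ
  rw [h1, h2, pw_append, mul_assoc, ← pw_insL hf, ← mul_assoc, ← pw_append f (List.take _ _) (List.drop _ _),
    List.take_append_drop]
  exact List.Pairwise.sublist (List.drop_sublist _ _) (sx_srt x β ρ hβ)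

/-- inverse word -/
def uw : ℕ → List (ℕ × ℕ) → List ℕ
  | 0, _ => []
  | x + 1, β => uw x β ++ blk x β

theorem pw_uw {M : Type*} [Monoid M] {f : ℕ → M} (hf : Kn f) (ρ : List ℕ)
    (β : List (ℕ × ℕ)) (hρ : Srt ρ) (hβ : BSrt β) (x : ℕ) :
    pw f (uw x β) = pw f (uw x (bumpB ρ β)) * pw f (sx x ρ β) := by
  induction x with
  | zero => simp [uw, sx_zero, pw_nil]
  | succ x ih =>
    rw [uw, uw, pw_append, pw_append, ih, mul_assoc, pw_local hf x ρ β hρ hβ, mul_assoc]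

def rowsProd {M : Type*} [Monoid M] (f : ℕ → M) (R : ℕ → List ℕ) : ℕ → M
  | 0 => 1
  | N + 1 => pw f (R N) * rowsProd f R N

theorem rowsProd_succ {M : Type*} [Monoid M] (f : ℕ → M) (R : ℕ → List ℕ) (N : ℕ) :
    rowsProd f R (N + 1) = rowsProd f (fun i => R (i + 1)) N * pw f (R 0) := by
  induction N with
  | zero => simp [rowsProd]
  | succ N ih => rw [rowsProd, ih, rowsProd, mul_assoc]

theorem uw_nil (x : ℕ) : uw x [] = [] := by
  induction x with
  | zero => rfl
  | succ x ih => simp [uw, ih, blk]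

theorem main_Q {M : Type*} [Monoid M] {f : ℕ → M} (hf : Kn f) (B N : ℕ) : 
    ∀ (P : List (List ℕ)) (β : List (ℕ × ℕ)), RowsSrt P → BSrt β → 
    (∀ r ∈ P, ∀ a ∈ r, a < B) → (∀ e ∈ β, e.2 < B) →
    (∀ i, N ≤ i → recRow P β i = []) →
    pw f (uw B β) = rowsProd f (recRow P β) N := by
  induction N with
  | zero =>
    intro P β hP hβ hPB hβB h
    have := recRow_length 0 β P h
    simp at this
    have : β = [] := by simpa using this.symm
    subst this
    simp [uw_nil, pw_nil, rowsProd]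
  | succ N ih =>
    have key : ∀ (ρ : List ℕ) (rest : List (List ℕ)) (β : List (ℕ × ℕ)), RowsSrt (ρ :: rest) →
      BSrt β → (∀ r ∈ ρ :: rest, ∀ a ∈ r, a < B) → (∀ e ∈ β, e.2 < B) →
      (∀ i, N + 1 ≤ i → recRow (ρ :: rest) β i = []) →
      pw f (uw B β) = rowsProd f (recRow (ρ :: rest) β) (N + 1) := by
      intro ρ rest β hP hβ hPB hβB h
      simp only [RowsSrt, List.mem_cons, forall_eq_or_imp] at hP hPB
      rw [pw_uw hf ρ β hP.1 hβ, sx_top B β ρ hPB.1 hβB, rowsProd_succ, recRow_zero]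
      congr 1
      rw [ih rest (bumpB ρ β) hP.2 (bumpB_srt β ρ hP.1 hβ) hPB.2 (bumpB_bound B β ρ hPB.1 hβB)]
      · congr 1
        funext i
        rw [recRow_succ]
      · intro i hi
        rw [← recRow_succ]
        exact h _ (by omega)
    intro P β hP hβ hPB hβB h
    rcases P with _ | ⟨ρ, rest⟩
    · have e : recRow ([] : List (List ℕ)) β = recRow [[]] β := by
        funext i; exact recRow_nil β i
      rw [e] at h ⊢
      exact key [] [] β (by simp [RowsSrt]) hβ (by simp) hβB h
    · exact key ρ rest β hP hβ hPB hβB h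
theorem end_mul {X : Type*} (f g : Function.End X) (x : X) : (f * g) x = f (g x) := rfl
theorem end_one {X : Type*} (x : X) : (1 : Function.End X) x = x := rfl

/-! actions -/
def df (a : ℕ) : Function.End ℕ := fun s => if s = a then s + 1 else s

theorem df_Kn : Kn df := by
  constructor
  · intro x y z h1 h2
    funext s
    simp only [end_mul, df]
    split_ifs <;> omega
  · intro x y z h1 h2
    funext s
    simp only [end_mul, df]
    split_ifs <;> omega

def lf (x a : ℕ) : Function.End (Option ℕ) := fun o =>
  match o with
  | none => none
  | some n => if a = x then some (n + 1) else if a = x + 1 then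
      (match n with | 0 => none | k + 1 => some k) else some n

theorem lf_Kn (x : ℕ) : Kn (lf x) := by
  constructor
  · intro a b c h1 h2
    funext s
    simp only [end_mul]
    rcases s with _ | _ | s <;> simp only [lf] <;> grind
  · intro a b c h1 h2
    funext s
    simp only [end_mul]
    rcases s with _ | _ | s <;> simp only [lf] <;> grind


theorem lf_none (x : ℕ) (l : List ℕ) : pw (lf x) l none = none := by
  induction l with
  | nil => simp [pw_nil, end_one]
  | cons a l ih => rw [pw_cons, end_mul, ih]; rfl

theorem lf_val (x : ℕ) (l : List ℕ) : ∀ n m, pw (lf x) l (some n) = some m →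
    l.count (x + 1) + m = l.count x + n := by
  induction l with
  | nil => intro n m h; simp [pw_nil, end_one] at h; simp [h]
  | cons a l ih =>
    intro n m h
    rw [pw_cons, end_mul] at h
    rcases hh : pw (lf x) l (some n) with _ | k
    · rw [hh] at h; simp [lf] at h
    · have := ih n k hh
      rw [hh] at h
      simp only [List.count_cons, beq_iff_eq]
      rcases k with _ | k <;> simp only [lf] at h <;> split_ifs at h ⊢ <;> simp at h <;> omega

theorem lf_suffix (x : ℕ) (l1 l2 : List ℕ) (h : pw (lf x) (l1 ++ l2) (some 0) ≠ none) :
    l2.count (x + 1) ≤ l2.count x ∧ pw (lf x) l2 (some 0) ≠ none := by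
  rw [pw_append, end_mul] at h
  rcases hh : pw (lf x) l2 (some 0) with _ | k
  · rw [hh, lf_none] at h; simp at h
  · have := lf_val x l2 0 k hh
    exact ⟨by omega, by simp⟩

theorem lf_row (x : ℕ) (l : List ℕ) : ∀ n, Srt l → l.count (x + 1) ≤ n →
    pw (lf x) l (some n) = some (n - l.count (x + 1) + l.count x) := by
  induction l with
  | nil => intro n _ _; simp [pw_nil, end_one]
  | cons a l ih =>
    intro n hs hn
    rw [Srt, List.pairwise_cons] at hs
    have h1 : l.count (x + 1) ≤ n := le_trans (by simp [List.count_cons]) hn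
    rw [pw_cons, end_mul, ih n hs.2 h1]
    simp only [List.count_cons, beq_iff_eq] at hn ⊢
    by_cases ha : a = x + 1
    · have h0 : l.count x = 0 := by
        rw [List.count_eq_zero]; intro hm; have := hs.1 x hm; omega
      rw [h0, if_pos ha] at *
      rw [if_neg (by omega)]
      obtain ⟨k, hk⟩ : ∃ k, n - l.count (x + 1) = k + 1 := ⟨n - l.count (x + 1) - 1, by omega⟩
      rw [hk]
      simp only [lf, ha]
      simp
      omega
    · rw [if_neg ha]
      by_cases hx : a = x
      · simp [lf, hx]; omega
      · simp [lf, hx, ha]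

theorem lf_rows (x : ℕ) (R : ℕ → List ℕ) (hR : ∀ i, Srt (R i))  (N : ℕ) :
    (∀ i < N, ∑ j ∈ Finset.range (i + 1), (R j).count (x + 1) ≤
      ∑ j ∈ Finset.range i, (R j).count x) →
    rowsProd (lf x) R N (some 0) =
      some (∑ j ∈ Finset.range N, (R j).count x - ∑ j ∈ Finset.range N, (R j).count (x + 1)) := by
  induction N with
  | zero => intro _; simp [rowsProd, end_one]
  | succ N ih =>
    intro h
    have h2 := h N (by omega)
    rw [Finset.sum_range_succ] at h2
    rw [rowsProd, end_mul, ih (fun i hi => h i (by omega)), lf_row _ _ _ (hR N) (by omega),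
      Finset.sum_range_succ, Finset.sum_range_succ]
    congr 1
    omega

theorem df_row (l : List ℕ) : ∀ s, Srt l → pw df l s = if s ∈ l then s + 1 else s := by
  induction l with
  | nil => intro s _; simp [pw_nil, end_one]
  | cons a l ih =>
    intro s hs
    rw [Srt, List.pairwise_cons] at hs
    rw [pw_cons, end_mul, ih s hs.2]
    by_cases hm : s ∈ l
    · have := hs.1 s hm
      rw [if_pos hm, if_pos (by simp [hm])]
      simp only [df]; rw [if_neg (by omega)]
    · rw [if_neg hm]
      by_cases h : s = a
      · simp [df, h]
      · simp [df, h, hm]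

def st (R : ℕ → List ℕ) : ℕ → ℕ
  | 0 => 0
  | N + 1 => if st R N ∈ R N then st R N + 1 else st R N

theorem df_rows (R : ℕ → List ℕ) (hR : ∀ i, Srt (R i)) (N : ℕ) : rowsProd df R N 0 = st R N := by
  induction N with
  | zero => simp [rowsProd, end_one, st]
  | succ N ih => rw [rowsProd, end_mul, ih, df_row _ _ (hR N), st]

theorem st_mono (R : ℕ → List ℕ) : Monotone (st R) := by
  apply monotone_nat_of_le_succ
  intro n
  rw [st]
  split_ifs <;> omega

theorem st_hit (R : ℕ → List ℕ) (N : ℕ) : ∀ k < st R N, ∃ i < N, st R i = k ∧ k ∈ R i := by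
  induction N with
  | zero => intro k hk; simp [st] at hk
  | succ N ih =>
    intro k hk
    rw [st] at hk
    by_cases h : k < st R N
    · obtain ⟨i, h1, h2⟩ := ih k h
      exact ⟨i, by omega, h2⟩
    · split_ifs at hk with hm
      · have : k = st R N := by omega
        exact ⟨N, by omega, this.symm, this ▸ hm⟩
      · omega

def Rrow (lam nu : ℕ → ℕ) (S : ℕ → ℕ → ℕ) (c0 : ℕ × ℕ) (i : ℕ) : List ℕ :=
  (if i = c0.1 then [0] else []) ++ (List.range (nu i - lam i)).map fun j => S i (lam i + j)

theorem mem_Srow {lam nu : ℕ → ℕ} {S : ℕ → ℕ → ℕ} {i k : ℕ} : 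
    k ∈ ((List.range (nu i - lam i)).map fun j => S i (lam i + j)) ↔
      ∃ j, InSkew lam nu i j ∧ S i j = k := by
  simp only [List.mem_map, List.mem_range, InSkew]
  constructor
  · rintro ⟨j, h1, h2⟩
    exact ⟨lam i + j, by omega, h2⟩
  · rintro ⟨j, h1, h2⟩
    exact ⟨j - lam i, by omega, by rw [← h2]; congr 1; omega⟩

theorem demo_of_rows (lam nu : ℕ → ℕ) (S : ℕ → ℕ → ℕ) (c0 : ℕ × ℕ) (r N : ℕ)
    (hlam : ∀ i j, i ≤ j → lam j ≤ lam i) (hnu : ∀ i j, i ≤ j → nu j ≤ nu i)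
    (hpos : ∀ i j, InSkew lam nu i j → 1 ≤ S i j)
    (hrow : ∀ i j j', InSkew lam nu i j → InSkew lam nu i j' → j ≤ j' → S i j ≤ S i j')
    (hcol : ∀ i i' j, InSkew lam nu i j → InSkew lam nu i' j → i < i' → S i j < S i' j)
    (hc0 : c0.2 + 1 = lam c0.1) (hN : ∀ i, N ≤ i → nu i = 0) (hr : 0 < r)
    (hst : st (Rrow lam nu S c0) N = r) : IsDemotion lam nu S c0 r := by
  classical
  set R := Rrow lam nu S c0 with hRdef
  have hmem : ∀ i k, 0 < k → (k ∈ R i ↔ ∃ j, InSkew lam nu i j ∧ S i j = k) := by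
    intro i k hk
    rw [hRdef, Rrow, List.mem_append, mem_Srow]
    constructor
    · rintro (h | h)
      · split_ifs at h <;> simp at h
        omega
      · exact h
    · exact Or.inr
  have hmem0 : ∀ i, 0 ∈ R i → i = c0.1 := by
    intro i h
    rw [hRdef, Rrow, List.mem_append, mem_Srow] at h
    rcases h with h | ⟨j, h1, h2⟩
    · split_ifs at h with hi
      · exact hi
      · simp at h
    · have := hpos i j h1
      omega
  have hit := st_hit R N
  rw [hst] at hit
  choose! I hI using hit
  have hI0 : I 0 = c0.1 := hmem0 _ (hI 0 hr).2.2
  have hsucc : ∀ k < r, st R (I k + 1) = k + 1 := by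
    intro k hk
    obtain ⟨h1, h2, h3⟩ := hI k hk
    rw [st, h2, if_pos h3]
  have hIlt : ∀ k, 0 < k → k < r → I (k - 1) < I k := by
    intro k h0 hk
    by_contra hc
    have h1 := st_mono R (not_lt.1 hc)
    have h2 := (hI k hk).2.1
    have h3 := (hI (k-1) (by omega)).2.1
    omega
  have hno : ∀ k, 0 < k → k ≤ r → ∀ j, I (k - 1) < j → j < N → (k < r → j < I k) → k ∉ R j := by
    intro k h0 hk j hj hjN hjI hm
    have h1 := hsucc (k - 1) (by omega)
    have h2 := st_mono R (show I (k - 1) + 1 ≤ j by omega)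
    have h4 : st R (j + 1) ≤ k := by
      rcases hk.lt_or_eq with h | h
      · have := st_mono R (show j + 1 ≤ I k from hjI h)
        rwa [(hI k h).2.1] at this
      · have := st_mono R (show j + 1 ≤ N by omega)
        omega
    have h5 := st_mono R (show j ≤ j + 1 by omega)
    have h6 : st R j = k := by omega
    rw [st, h6, if_pos hm] at h4
    omega
  let Pr : ℕ → ℕ → Prop := fun k j => InSkew lam nu (I k) j ∧ S (I k) j = k
  let J : ℕ → ℕ := fun k => Nat.findGreatest (Pr k) (nu (I k))
  have hJ : ∀ k, 0 < k → k < r → Pr k (J k) := by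
    intro k h0 hk
    obtain ⟨j, hj⟩ := (hmem _ k h0).1 (hI k hk).2.2
    exact Nat.findGreatest_spec (P := Pr k) (m := j) hj.1.2.le hj
  have hJmax : ∀ k j, Pr k j → j ≤ J k := by
    intro k j hj
    exact Nat.le_findGreatest hj.1.2.le hj
  let c : ℕ → ℕ × ℕ := fun k => if k = 0 then c0 else (I k, J k)
  have hc1 : ∀ k, (c k).1 = I k := by
    intro k
    by_cases h : k = 0
    · simp [c, h, hI0]
    · simp [c, h]
  have hcpos : ∀ k, 0 < k → c k = (I k, J k) := by
    intro k hk
    simp [c, hk.ne']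
  have anchor : ∀ k, 0 < k → k ≤ r → ∀ p : ℕ × ℕ, InSkew lam nu p.1 p.2 → S p.1 p.2 = k →
      (ColOrder (c (k - 1)) p ↔ I (k - 1) < p.1) := by
    rintro k h0 hk ⟨i', j'⟩ hp hSp
    simp only at hp hSp
    rcases Nat.lt_or_ge 1 k with h1 | h1
    · have hcc := hcpos (k - 1) (by omega)
      obtain ⟨q1, q2⟩ := hJ (k - 1) (by omega) (by omega)
      have q3 : ∀ j, InSkew lam nu (I (k - 1)) j ∧ S (I (k - 1)) j = k - 1 → j ≤ J (k - 1) :=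
        hJmax (k - 1)
      rw [hcc]
      simp only [ColOrder]
      generalize I (k - 1) = i at *
      generalize J (k - 1) = j at *
      constructor
      · rintro (h | h)
        · by_contra hc
          rcases (not_lt.1 hc).lt_or_eq with hlt | heq
          · have hs : InSkew lam nu i j' := ⟨(hlam _ _ hlt.le).trans hp.1, h.trans q1.2⟩
            have a1 := hcol _ _ _ hp hs hlt
            have a2 := hrow _ _ _ hs q1 h.le
            omega
          · subst heq
            have a2 := hrow _ _ _ hp q1 h.le
            omega
        · exact h.2
      · intro h
        rcases Nat.lt_or_ge j j' with hc | hc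
        · exfalso
          have hs : InSkew lam nu i j' := ⟨q1.1.trans hc.le, lt_of_lt_of_le hp.2 (hnu _ _ h.le)⟩
          have a1 := hcol _ _ _ hs hp h
          have a2 := hrow _ _ _ q1 hs hc.le
          have := q3 j' ⟨hs, by omega⟩
          omega
        · omega
    · have hk1 : k = 1 := by omega
      subst hk1
      have : c (1 - 1) = c0 := by simp [c]
      rw [this]
      simp only [Nat.sub_self, hI0, ColOrder]
      constructor
      · rintro (h | h)
        · by_contra hc
          have := hlam _ _ (not_lt.1 hc)
          have := hp.1
          omega
        · exact h.2
      · intro h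
        rcases Nat.lt_or_ge c0.2 j' with hc | hc
        · exfalso
          have hs : InSkew lam nu c0.1 j' := ⟨by omega, lt_of_lt_of_le hp.2 (hnu _ _ h.le)⟩
          have a1 := hcol _ _ _ hs hp h
          have a2 := hpos _ _ hs
          omega
        · omega
  have hpN : ∀ p : ℕ × ℕ, InSkew lam nu p.1 p.2 → p.1 < N := by
    intro p hp
    by_contra hc
    have := hN _ (not_lt.1 hc)
    have := hp.2
    omega
  refine ⟨hr, c, by simp [c], ?_, ?_⟩
  · intro k h0 hk
    obtain ⟨q1, q2⟩ := hJ k h0 hk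
    have hcc := hcpos k h0
    refine ⟨by rw [hcc]; exact q1, by rw [hcc]; exact q2, ?_, ?_⟩
    · rw [anchor k h0 hk.le, hc1]
      · exact hIlt k h0 hk
      · rw [hcc]; exact q1
      · rw [hcc]; exact q2
    · rintro p hp hSp hord
      rw [anchor k h0 hk.le p hp hSp] at hord
      have hge : I k ≤ p.1 := by
        by_contra hc
        exact hno k h0 hk.le p.1 hord (hpN p hp) (fun _ => not_le.1 hc)
          ((hmem _ k h0).2 ⟨p.2, hp, hSp⟩)
      rw [hcc]
      simp only [ColOrder]
      rintro (h | h)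
      · rcases hge.lt_or_eq with hlt | heq
        · have hs : InSkew lam nu p.1 (J k) := ⟨(hlam _ _ hlt.le).trans q1.1, h.trans hp.2⟩
          have a1 := hcol _ _ _ q1 hs hlt
          have a2 := hrow _ _ _ hs hp h.le
          omega
        · have := hJmax k p.2 ⟨by rw [heq]; exact hp, by rw [heq]; exact hSp⟩
          omega
      · omega
  · intro p hp hSp hord
    rw [anchor r hr le_rfl p hp hSp] at hord
    exact hno r hr le_rfl p.1 hord (hpN p hp) (fun h => absurd h (lt_irrefl _))
      ((hmem _ r hr).2 ⟨p.2, hp, hSp⟩)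
theorem insertRowIdx_le (P : List (List ℕ)) : ∀ x, insertRowIdx P x ≤ P.length + 1 := by
  induction P with
  | nil => intro x; simp [insertRowIdx]
  | cons row rest ih =>
    intro x
    rcases hi : insertRow row x with ⟨a', _ | z⟩
    · simp [insertRowIdx, hi]
    · simpa [insertRowIdx, hi] using ih z

theorem insertTab_length (P : List (List ℕ)) : ∀ x,
    (insertTab P x).length = max P.length (insertRowIdx P x) := by
  induction P with
  | nil => intro x; simp [insertRowIdx, insertTab]
  | cons row rest ih =>
    intro x
    rcases hi : insertRow row x with ⟨a', _ | z⟩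
    · simp [insertRowIdx, insertTab, hi]
    · simp [insertRowIdx, insertTab, hi, ih z]

theorem placeAt_length (Q : List (List ℤ)) (r : ℕ) (q : ℤ) (h1 : 1 ≤ r) (h2 : r ≤ Q.length + 1) :
    (placeAt Q r q).length = max Q.length r := by
  unfold placeAt
  split_ifs <;> simp <;> omega

theorem placeAt_getD (Q : List (List ℤ)) (r : ℕ) (q : ℤ) (h1 : 1 ≤ r) (h2 : r ≤ Q.length + 1)
    (i : ℕ) : (placeAt Q r q).getD i [] = Q.getD i [] ++ if r = i + 1 then [q] else [] := by
  unfold placeAt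
  split_ifs with h3 h4 h4
  · subst h4
    simp at h3
    simp [List.getD, h3]
  · simp [List.getD, List.getElem?_set, show r - 1 ≠ i by omega]
  · have : i = Q.length := by omega
    subst this
    simp [List.getD]
  · simp only [List.getD, List.append_nil]
    rcases lt_trichotomy i Q.length with h | h | h
    · rw [List.getElem?_append_left h]
    · omega
    · rw [List.getElem?_eq_none (by simp; omega), List.getElem?_eq_none (by omega)]

theorem RSK_fold (om : List (ℤ × ℕ)) : ∀ P Q, P.length = Q.length →
    (om.foldl RSKstep (P, Q)).1 = (om.map Prod.snd).foldl insertTab P ∧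
    ∀ i, (om.foldl RSKstep (P, Q)).2.getD i [] = Q.getD i [] ++ recRow P om i := by
  induction om with
  | nil => intro P Q _; simp [recRow]
  | cons e om ih =>
    intro P Q h
    have h1 := insertRowIdx_pos P e.2
    have h2 := insertRowIdx_le P e.2
    rw [h] at h2
    have := ih (insertTab P e.2) (placeAt Q (insertRowIdx P e.2) e.1) (by
      rw [insertTab_length, placeAt_length _ _ _ h1 h2, h])
    simp only [List.foldl_cons, RSKstep, List.map_cons]
    refine ⟨this.1, fun i => ?_⟩
    rw [this.2 i, placeAt_getD _ _ _ h1 h2, recRow]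
    split_ifs <;> simp

theorem srt_split {α : Type*} (R : α → α → Prop) (p : α → Bool) (hp : ∀ a b, R a b → p a → p b)
    (l : List α) (h : l.Pairwise R) :
    l = l.filter (fun a => !p a) ++ l.filter p := by
  induction l with
  | nil => simp
  | cons a l ih =>
    rw [List.pairwise_cons] at h
    by_cases ha : p a = true
    · have h1 : ∀ b ∈ l, p b = true := fun b hb => hp a b (h.1 b hb) ha
      have h2 : l.filter (fun a => !p a) = [] := by
        rw [List.filter_eq_nil_iff]; intro b hb; simp [h1 b hb]
      have h3 : l.filter p = l := by
        rw [List.filter_eq_self]; exact h1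
      simp [List.filter_cons, ha, h2, h3]
    · have ih := ih h.2
      simp only [Bool.not_eq_true] at ha
      simp [List.filter_cons, ha, ← ih]

theorem countP_split {α : Type*} (p q r : α → Bool) (l : List α)
    (h : ∀ e, (if p e = true then 1 else 0) =
      (if q e = true then 1 else 0) + (if r e = true then 1 else 0)) :
    l.countP p = l.countP q + l.countP r := by
  induction l with
  | nil => simp
  | cons a l ih =>
    have := h a
    rw [List.countP_cons, List.countP_cons, List.countP_cons, ih]
    omega

theorem blk_count (x t : ℕ) (β : List (ℕ × ℕ)) :
    (blk x β).count t = β.countP (fun e => e.1 = t ∧ e.2 = x) := by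
  induction β with
  | nil => simp [blk]
  | cons e β ih =>
    rw [blk_cons, List.countP_cons]
    split_ifs <;> simp_all [List.count_cons]

theorem blk_srt (x : ℕ) (β : List (ℕ × ℕ)) (h : BSrt β) : Srt (blk x β) := by
  induction β with
  | nil => simp [blk]
  | cons e β ih =>
    rw [BSrt, List.pairwise_cons] at h
    rw [blk_cons]
    split_ifs
    · rw [Srt, List.pairwise_cons]
      refine ⟨?_, ih h.2⟩
      intro t ht
      have := h.1 _ (mem_blk.1 ht)
      omega
    · exact ih h.2

theorem uw_split (β : List (ℕ × ℕ)) (h : BSrt β) (x t B : ℕ) (hx : x < B) :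
    ∃ l1 l2, uw B β = l1 ++ l2 ∧
      l2.count (t + 1) = β.countP (fun e => e.1 = t + 1 ∧ x ≤ e.2 ∧ e.2 < B) ∧
      l2.count t = β.countP (fun e => e.1 = t ∧ x + 1 ≤ e.2 ∧ e.2 < B) := by
  induction B, hx using Nat.le_induction with
  | base =>
    have hs := srt_split (· ≤ ·) (fun a => decide (t + 1 ≤ a))
      (by intro a b h1 h2; simp at *; omega) (blk x β) (blk_srt x β h)
    refine ⟨uw x β ++ (blk x β).filter (fun a => !decide (t + 1 ≤ a)),
      (blk x β).filter (fun a => decide (t + 1 ≤ a)), ?_, ?_, ?_⟩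
    · rw [List.append_assoc, ← hs, uw]
    · rw [List.count_filter (by simp), blk_count]
      congr 1; funext e; simp only [decide_eq_decide]; omega
    · rw [List.count_eq_zero.2 (by simp), eq_comm, List.countP_eq_zero]
      intro e _; simp only [decide_eq_true_eq]; omega
  | succ B hB ih =>
    obtain ⟨l1, l2, e1, e2, e3⟩ := ih
    refine ⟨l1, l2 ++ blk B β, by rw [uw, e1, List.append_assoc], ?_, ?_⟩
    · rw [List.count_append, e2, blk_count, eq_comm]
      apply countP_split
      intro e
      simp only [decide_eq_true_eq]
      split_ifs <;> omega
    · rw [List.count_append, e3, blk_count, eq_comm]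
      apply countP_split
      intro e
      simp only [decide_eq_true_eq]
      split_ifs <;> omega

theorem w_split (β : List (ℕ × ℕ)) (h : BSrt β) (x t : ℕ) :
    ∃ l1 l2, β.map Prod.snd = l1 ++ l2 ∧
      l2.count (x + 1) = β.countP (fun e => t ≤ e.1 ∧ e.2 = x + 1) ∧
      l2.count x = β.countP (fun e => t + 1 ≤ e.1 ∧ e.2 = x) := by
  have hs := srt_split _ (fun e : ℕ × ℕ => decide (t < e.1 ∨ (e.1 = t ∧ x + 1 ≤ e.2)))
      (by intro a b h1 h2; simp at *; omega) β h
  refine ⟨_, _, by conv_lhs => rw [hs, List.map_append], ?_, ?_⟩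
  · rw [List.count, List.countP_map, List.countP_filter]
    congr 1; funext e; rw [Bool.eq_iff_iff]
    simp only [Function.comp, Bool.and_eq_true, decide_eq_true_eq, beq_iff_eq]; omega
  · rw [List.count, List.countP_map, List.countP_filter]
    congr 1; funext e; rw [Bool.eq_iff_iff]
    simp only [Function.comp, Bool.and_eq_true, decide_eq_true_eq, beq_iff_eq]; omega

theorem fold_uw (β : List (ℕ × ℕ)) (r B : ℕ) (hs : BSrt β) (h1 : ∀ e ∈ β, 1 ≤ e.1 ∧ 1 ≤ e.2 ∧ e.2 < B)
    (hr : 1 ≤ r) (hrB : r < B)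
    (hw : ∀ x, 1 ≤ x → pw (lf x) (r :: β.map Prod.snd) (some 0) ≠ none)
    (hu : ∀ t, 1 ≤ t → pw (lf t) (uw B β) (some 0) ≠ none) :
    pw df (uw B ((0, r) :: β)) 0 = r := by
  let C : ℕ → ℕ → ℕ := fun t x => β.countP (fun e => t ≤ e.1 ∧ x ≤ e.2)
  let A : ℕ → ℕ → ℕ := fun t x => β.countP (fun e => e.1 = t ∧ x ≤ e.2)
  let D : ℕ → ℕ → ℕ := fun t x => β.countP (fun e => t ≤ e.1 ∧ e.2 = x)
  let b : ℕ → ℕ → ℕ := fun t x => β.countP (fun e => e.1 = t ∧ e.2 = x)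
  have cA : ∀ t x, C t x = A t x + C (t + 1) x := by
    intro t x; apply countP_split; intro e
    simp only [decide_eq_true_eq]; split_ifs <;> omega
  have cD : ∀ t x, C t x = D t x + C t (x + 1) := by
    intro t x; apply countP_split; intro e
    simp only [decide_eq_true_eq]; split_ifs <;> omega
  have cAb : ∀ t x, A t x = b t x + A t (x + 1) := by
    intro t x; apply countP_split; intro e
    simp only [decide_eq_true_eq]; split_ifs <;> omega
  have cDb : ∀ t x, D t x = b t x + D (t + 1) x := by
    intro t x; apply countP_split; intro e
    simp only [decide_eq_true_eq]; split_ifs <;> omega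
  have hA : ∀ t x, 1 ≤ t → A (t + 1) x ≤ A t (x + 1) := by
    intro t x ht
    by_cases hx : x < B
    · obtain ⟨l1, l2, e1, e2, e3⟩ := uw_split β hs x t B hx
      have := hu t ht
      rw [e1] at this
      have := (lf_suffix _ _ _ this).1
      rw [e2, e3] at this
      have f1 : A (t + 1) x = β.countP (fun e => e.1 = t + 1 ∧ x ≤ e.2 ∧ e.2 < B) := by
        apply List.countP_congr; intro e he; have := h1 e he; simp; omega
      have f2 : A t (x + 1) = β.countP (fun e => e.1 = t ∧ x + 1 ≤ e.2 ∧ e.2 < B) := by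
        apply List.countP_congr; intro e he; have := h1 e he; simp; omega
      omega
    · have : A (t + 1) x = 0 := by
        apply List.countP_eq_zero.2; intro e he; have := h1 e he; simp; omega
      omega
  have hw' : ∀ x, 1 ≤ x → pw (lf x) (β.map Prod.snd) (some 0) ≠ none := fun x hx =>
    (lf_suffix x [r] _ (hw x hx)).2
  have hD : ∀ t x, 1 ≤ x → D t (x + 1) ≤ D (t + 1) x := by
    intro t x hx
    obtain ⟨l1, l2, e1, e2, e3⟩ := w_split β hs x t
    have := hw' x hx
    rw [e1] at this
    have := (lf_suffix _ _ _ this).1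
    rw [e2, e3] at this
    exact this
  obtain ⟨T, hT⟩ : ∃ T, ∀ e ∈ β, e.1 < T := by
    refine ⟨(β.map Prod.fst).sum + 1, fun e he => ?_⟩
    have := List.single_le_sum (l := β.map Prod.fst) (by simp) e.1 (List.mem_map_of_mem he)
    omega
  have C0 : ∀ t x, T ≤ t → C t x = 0 := by
    intro t x h; apply List.countP_eq_zero.2; intro e he; have := hT e he; simp; omega
  have C0' : ∀ t x, B ≤ x → C t x = 0 := by
    intro t x h; apply List.countP_eq_zero.2; intro e he; have := h1 e he; simp; omega
  have ineq1 : ∀ d t x, T ≤ t + d → 1 ≤ t → C (t + 1) x ≤ C t (x + 1) := by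
    intro d
    induction d with
    | zero => intro t x h _; rw [C0 (t + 1) x (by omega)]; omega
    | succ d ih =>
      intro t x h ht
      have a1 := ih (t + 1) x (by omega) (by omega)
      have a2 := cA (t + 1) x
      have a3 := cA t (x + 1)
      have a4 := hA t x ht
      omega
  have ineq2 : ∀ d t x, B ≤ x + d → 1 ≤ x → C t (x + 1) ≤ C (t + 1) x := by
    intro d
    induction d with
    | zero => intro t x h _; rw [C0' t (x + 1) (by omega)]; omega
    | succ d ih =>
      intro t x h ht
      have a1 := ih t (x + 1) (by omega) (by omega)
      have a2 := cD t (x + 1)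
      have a3 := cD (t + 1) x
      have a4 := hD t x ht
      omega
  have Ceq : ∀ t x, 1 ≤ t → 1 ≤ x → C (t + 1) x = C t (x + 1) := fun t x ht hx =>
    le_antisymm (ineq1 T t x (by omega) ht) (ineq2 B t x (by omega) hx)
  have Deq : ∀ t x, 1 ≤ t → 1 ≤ x → D t (x + 1) = D (t + 1) x := by
    intro t x ht hx
    have a1 := cD t (x + 1)
    have a2 := cD (t + 1) x
    have a3 := Ceq t x ht hx
    have a4 := Ceq t (x + 1) ht (by omega)
    omega
  have beq : ∀ t x, 1 ≤ t → 1 ≤ x → b t (x + 1) = b (t + 1) x := by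
    intro t x ht hx
    have a1 := cDb t (x + 1)
    have a2 := cDb (t + 1) x
    have a3 := Deq t x ht hx
    have a4 := Deq (t + 1) x (by omega) hx
    omega
  have bstart : 2 ≤ r → 1 ≤ b 1 (r - 1) := by
    intro h2
    have a1 := hw (r - 1) (by omega)
    have a2 := (lf_suffix (r - 1) [] _ (by simpa using a1)).1
    rw [List.count_cons, List.count_cons] at a2
    have hrr : r - 1 + 1 = r := by omega
    rw [hrr] at a2
    simp only [beq_self_eq_true, if_true, beq_iff_eq] at a2
    rw [if_neg (by omega)] at a2
    have a3 : ∀ x, (β.map Prod.snd).count x = D 1 x := by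
      intro x
      rw [List.count, List.countP_map]
      apply List.countP_congr
      intro e he
      have := h1 e he
      simp; omega
    rw [a3, a3] at a2
    have a4 := Deq 1 (r - 1) le_rfl (by omega)
    rw [hrr] at a4
    have a5 := cDb 1 (r - 1)
    omega
  have ball : ∀ k, k + 2 ≤ r → 1 ≤ b (k + 1) (r - 1 - k) := by
    intro k
    induction k with
    | zero => intro h; simpa using bstart h
    | succ k ih =>
      intro h
      have a1 := ih (by omega)
      have a2 := beq (k + 1) (r - 1 - (k + 1)) (by omega) (by omega)
      rw [show r - 1 - (k + 1) + 1 = r - 1 - k by omega] at a2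
      omega
  have hs' : BSrt ((0, r) :: β) := by
    rw [BSrt, List.pairwise_cons]
    refine ⟨fun e he => ?_, hs⟩
    have := h1 e he
    left; simp; omega
  have step : ∀ x s, pw df (uw (x + 1) ((0, r) :: β)) s =
      pw df (uw x ((0, r) :: β)) (if (s, x) ∈ (0, r) :: β then s + 1 else s) := by
    intro x s
    rw [uw, pw_append, end_mul, df_row _ _ (blk_srt x _ hs')]
    simp only [mem_blk]
  have up : ∀ d, pw df (uw (r + 1 + d) ((0, r) :: β)) 0 = pw df (uw (r + 1) ((0, r) :: β)) 0 := by
    intro d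
    induction d with
    | zero => rfl
    | succ d ih =>
      rw [← add_assoc, step, if_neg, ih]
      intro hm
      rcases List.mem_cons.1 hm with h | h
      · simp at h
        omega
      · have := (h1 _ h).1
        simp at this
  have down : ∀ x s, x + s = r + 1 → 1 ≤ x → 1 ≤ s → pw df (uw x ((0, r) :: β)) s = r := by
    intro x
    induction x with
    | zero => intro s _ h; omega
    | succ x ih =>
      intro s h _ hs1
      rcases Nat.eq_zero_or_pos x with hx | hx
      · subst hx
        rw [step, if_neg]
        · simp [uw, pw_nil, end_one]; omega
        · intro hm
          rcases List.mem_cons.1 hm with h | h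
          · simp at h; omega
          · have := (h1 _ h).2.1
            simp at this
      · have a1 := ball (s - 1) (by omega)
        rw [show s - 1 + 1 = s by omega, show r - 1 - (s - 1) = x by omega] at a1
        have a2 := List.countP_pos_iff.1 a1
        obtain ⟨e, he, h3⟩ := a2
        simp at h3
        have : (s, x) ∈ β := by
          have : e = (s, x) := Prod.ext h3.1 h3.2
          rwa [← this]
        rw [step, if_pos (by simp [this])]
        exact ih (s + 1) (by omega) hx (by omega)
  have := up (B - (r + 1))
  rw [show r + 1 + (B - (r + 1)) = B by omega] at this
  rw [this, step, if_pos (by simp)]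
  exact down r 1 rfl hr le_rfl
def Srow (lam nu : ℕ → ℕ) (S : ℕ → ℕ → ℕ) (i : ℕ) : List ℕ :=
  (List.range (nu i - lam i)).map fun j => S i (lam i + j)

theorem count_map_range (g : ℕ → ℕ) (k m : ℕ) :
    ((List.range m).map g).count k = ((Finset.range m).filter (fun j => g j = k)).card := by
  induction m with
  | zero => simp
  | succ m ih =>
    rw [List.range_succ, List.map_append, List.count_append, ih, Finset.range_add_one,
      Finset.filter_insert]
    split_ifs with h
    · rw [Finset.card_insert_of_notMem (by simp)]; simp [h]
    · simp [h]

theorem skew_ncard (lam nu : ℕ → ℕ) (S : ℕ → ℕ → ℕ) (k N : ℕ) :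
    {p : ℕ × ℕ | p.1 < N ∧ InSkew lam nu p.1 p.2 ∧ S p.1 p.2 = k}.Finite ∧
    {p : ℕ × ℕ | p.1 < N ∧ InSkew lam nu p.1 p.2 ∧ S p.1 p.2 = k}.ncard =
      ∑ i ∈ Finset.range N, (Srow lam nu S i).count k := by
  have key : {p : ℕ × ℕ | p.1 < N ∧ InSkew lam nu p.1 p.2 ∧ S p.1 p.2 = k} =
      ↑(((Finset.range N).sigma (fun i => (Finset.range (nu i - lam i)).filter
        (fun j => S i (lam i + j) = k))).image (fun s => (s.1, lam s.1 + s.2))) := by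
    ext ⟨i, j⟩
    simp only [Set.mem_setOf_eq, Finset.coe_image, Set.mem_image, Finset.mem_coe, Finset.mem_sigma,
      Finset.mem_filter, Finset.mem_range, Prod.mk.injEq, InSkew]
    constructor
    · rintro ⟨h1, ⟨h2, h3⟩, h4⟩
      refine ⟨⟨i, j - lam i⟩, ⟨h1, by simp; omega, ?_⟩, rfl, by simp; omega⟩
      simp only
      rw [show lam i + (j - lam i) = j by omega]; exact h4
    · rintro ⟨⟨a, b⟩, ⟨h1, h2, h3⟩, rfl, rfl⟩
      exact ⟨h1, ⟨by simp, by simp at *; omega⟩, h3⟩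
  rw [key]
  refine ⟨Finset.finite_toSet _, ?_⟩
  rw [Set.ncard_coe_finset, Finset.card_image_of_injOn, Finset.card_sigma]
  · apply Finset.sum_congr rfl
    intro i _
    rw [Srow, count_map_range]
  · rintro ⟨a, b⟩ _ ⟨c, d⟩ _ h
    simp only [Prod.mk.injEq] at h
    obtain ⟨rfl, h⟩ := h
    simp at h
    rw [h]

theorem ballot_counts {lam mu nu : ℕ → ℕ} {S : ℕ → ℕ → ℕ} (hS : IsLRTableau lam mu nu S) (k i : ℕ) :
    ∑ j ∈ Finset.range (i + 1), (Srow lam nu S j).count (k + 2) ≤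
      ∑ j ∈ Finset.range i, (Srow lam nu S j).count (k + 1) := by
  obtain ⟨_, _, _, _, _, _, hrow, _, _, hbal⟩ := hS
  induction i with
  | zero =>
    by_contra hcon
    have : 0 < (Srow lam nu S 0).count (k + 2) := by
      rw [Finset.sum_range_one] at hcon; omega
    rw [List.count_pos_iff, Srow, mem_Srow] at this
    obtain ⟨j, hj, hj2⟩ := this
    have := hbal k (0, j) hj hj2
    have h1 : {p : ℕ × ℕ | InSkew lam nu p.1 p.2 ∧ S p.1 p.2 = k + 1 ∧ ReadBefore p (0, j)} = ∅ := by
      ext ⟨a, b⟩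
      simp only [Set.mem_setOf_eq, Set.mem_empty_iff_false, iff_false, ReadBefore]
      rintro ⟨h1, h2, h3⟩
      have ha : a = 0 := by omega
      subst ha
      have := hrow 0 j b hj h1 (by omega)
      omega
    rw [h1, Set.ncard_empty] at this
    have hfin : {p : ℕ × ℕ | InSkew lam nu p.1 p.2 ∧ S p.1 p.2 = k + 2 ∧ ReadBefore p (0, j)}.Finite := by
      apply (skew_ncard lam nu S (k + 2) 1).1.subset
      rintro ⟨a, b⟩ ⟨h1, h2, h3⟩
      simp only [ReadBefore] at h3
      exact ⟨by simp; omega, h1, h2⟩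
    have h2 := (Set.ncard_eq_zero hfin).1 (by omega)
    have : ((0, j) : ℕ × ℕ) ∈ (∅ : Set (ℕ × ℕ)) := by
      rw [← h2]; exact ⟨hj, hj2, Or.inr ⟨rfl, le_rfl⟩⟩
    exact this
  | succ i ih =>
    by_cases hm : k + 2 ∈ Srow lam nu S (i + 1)
    · rw [Srow, mem_Srow] at hm
      classical
      let j := Nat.find hm
      obtain ⟨hj, hj2⟩ : InSkew lam nu (i + 1) j ∧ S (i + 1) j = k + 2 := Nat.find_spec hm
      have hmin : ∀ b, InSkew lam nu (i + 1) b → S (i + 1) b = k + 2 → j ≤ b := fun b h1 h2 =>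
        Nat.find_min' hm ⟨h1, h2⟩
      have := hbal k (i + 1, j) hj hj2
      rw [← (skew_ncard lam nu S (k + 2) _).2, ← (skew_ncard lam nu S (k + 1) _).2]
      have e1 : {p : ℕ × ℕ | InSkew lam nu p.1 p.2 ∧ S p.1 p.2 = k + 2 ∧ ReadBefore p (i + 1, j)} =
          {p : ℕ × ℕ | p.1 < i + 1 + 1 ∧ InSkew lam nu p.1 p.2 ∧ S p.1 p.2 = k + 2} := by
        ext ⟨a, b⟩
        simp only [Set.mem_setOf_eq, ReadBefore]
        constructor
        · rintro ⟨h1, h2, h3⟩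
          exact ⟨by omega, h1, h2⟩
        · rintro ⟨h1, h2, h3⟩
          refine ⟨h2, h3, ?_⟩
          rcases Nat.lt_or_ge a (i + 1) with h | h
          · exact Or.inl h
          · have ha : a = i + 1 := by omega
            subst ha
            exact Or.inr ⟨rfl, hmin b h2 h3⟩
      rw [e1] at this
      refine this.trans (Set.ncard_le_ncard ?_ (skew_ncard lam nu S (k + 1) _).1)
      rintro ⟨a, b⟩ ⟨h1, h2, h3⟩
      refine ⟨?_, h1, h2⟩
      simp only [ReadBefore] at *
      by_contra hc
      have ha : a = i + 1 := by omega
      subst ha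
      have := hrow (i + 1) j b hj h1 (by omega)
      omega
    · rw [Finset.sum_range_succ, List.count_eq_zero.2 hm]
      rw [Finset.sum_range_succ (fun j => (Srow lam nu S j).count (k + 1))]
      omega

theorem wordP_rows {M : Type*} [Monoid M] (f : ℕ → M) (L : ℕ) : ∀ (R : ℕ → List ℕ),
    wordP f ((List.range L).map R) = rowsProd f R L := by
  induction L with
  | zero => intro R; rfl
  | succ L ih =>
    intro R
    rw [List.range_succ_eq_map, List.map_cons, List.map_map, wordP, rowsProd_succ]
    rw [← ih]; rfl

theorem insertTab_bound (B : ℕ) (P : List (List ℕ)) : ∀ x, x < B → (∀ r ∈ P, ∀ a ∈ r, a < B) →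
    ∀ r ∈ insertTab P x, ∀ a ∈ r, a < B := by
  induction P with
  | nil => intro x hx _; simpa [insertTab] using hx
  | cons row rest ih =>
    intro x hx hP
    have h0 := hP row (by simp)
    have h1 : ∀ r ∈ rest, ∀ a ∈ r, a < B := fun r hr => hP r (by simp [hr])
    rcases hi : insertRow row x with ⟨a', _ | z⟩
    · have := (insertRow_none hi).1
      simp only [insertTab, hi]
      intro r hr
      rcases List.mem_cons.1 hr with rfl | hr
      · subst this
        intro a ha
        rcases List.mem_append.1 ha with h | h
        · exact h0 a h
        · simp at h; omega
      · exact h1 r hr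
    · obtain ⟨l, r', e1, e2, _, _⟩ := insertRow_some hi
      simp only [insertTab, hi]
      intro r hr
      rcases List.mem_cons.1 hr with rfl | hr
      · subst e1 e2
        intro a ha
        simp at ha h0
        rcases ha with h | h | h
        · exact h0 a (Or.inl h)
        · omega
        · exact h0 a (Or.inr (Or.inr h))
      · exact ih z (h0 z (by simp [e1])) h1 r hr

theorem foldl_bound (B : ℕ) (w : List ℕ) : ∀ P : List (List ℕ), (∀ x ∈ w, x < B) →
    (∀ r ∈ P, ∀ a ∈ r, a < B) → ∀ r ∈ w.foldl insertTab P, ∀ a ∈ r, a < B := by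
  induction w with
  | nil => intro P _ h; exact h
  | cons x w ih =>
    intro P h1 h2
    exact ih _ (fun y hy => h1 y (by simp [hy])) (insertTab_bound B P x (h1 x (by simp)) h2)

theorem recRow_top {τ : Type*} (β : List (τ × ℕ)) : ∀ P, ∀ e ∈ β, ∃ i, e.1 ∈ recRow P β i := by
  induction β with
  | nil => intro P e h; simp at h
  | cons e β ih =>
    intro P e' h
    rcases List.mem_cons.1 h with rfl | h
    · refine ⟨insertRowIdx P e'.2 - 1, ?_⟩
      have := insertRowIdx_pos P e'.2
      rw [recRow, if_pos (by omega)]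
      simp
    · obtain ⟨i, hi⟩ := ih (insertTab P e.2) e' h
      refine ⟨i, ?_⟩
      rw [recRow]
      split_ifs <;> simp [hi]

theorem recRow_find {τ : Type*} (β : List (τ × ℕ)) (i : ℕ) (t : τ) : ∀ P, t ∈ recRow P β i →
    ∃ β1 y β2, β = β1 ++ (t, y) :: β2 ∧
      insertRowIdx ((β1.map Prod.snd).foldl insertTab P) y = i + 1 := by
  induction β with
  | nil => intro P h; simp [recRow] at h
  | cons e β ih =>
    intro P h
    have hrec : t ∈ recRow (insertTab P e.2) β i → ∃ β1 y β2, e :: β = β1 ++ (t, y) :: β2 ∧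
      insertRowIdx ((β1.map Prod.snd).foldl insertTab P) y = i + 1 := by
      intro h
      obtain ⟨β1, y, β2, e1, e2⟩ := ih _ h
      exact ⟨e :: β1, y, β2, by rw [e1]; rfl, by simpa using e2⟩
    rw [recRow] at h
    split_ifs at h with h1
    · rcases List.mem_cons.1 h with rfl | h
      · exact ⟨[], e.2, β, rfl, h1⟩
      · exact hrec h
    · exact hrec h

theorem app_split {α : Type*} (p : α → Bool) (A B C D : List α) (h : A ++ B = C ++ D)
    (hA : ∀ a ∈ A, p a = true) (hB : ∀ a ∈ B, p a = false) (hC : ∀ a ∈ C, p a = true)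
    (hD : ∀ a ∈ D, p a = false) : A = C ∧ B = D := by
  have h1 := congrArg (List.filter p) h
  rw [List.filter_append, List.filter_append, List.filter_eq_self.2 hA, List.filter_eq_self.2 hC,
    List.filter_eq_nil_iff.2 (by simpa using hB), List.filter_eq_nil_iff.2 (by simpa using hD)] at h1
  simp only [List.append_nil] at h1
  subst h1
  exact ⟨rfl, List.append_cancel_left h⟩
theorem last_idx (lam : ℕ → ℕ) (T0 : ℕ → ℕ → ℤ) (c0 : ℕ × ℕ) (om1 : List (ℤ × ℕ)) (t : ℤ) (x : ℕ)
    (hlam : ∀ i j, i ≤ j → lam j ≤ lam i)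
    (hT0row : ∀ i j j', j ≤ j' → j' < lam i → T0 i j ≤ T0 i j')
    (hT0col : ∀ i i' j, i < i' → j < lam i' → T0 i j < T0 i' j)
    (hc0 : c0.2 < lam c0.1)
    (hmax : ∀ i j, j < lam i → T0 i j ≤ T0 c0.1 c0.2)
    (hright : ∀ i j, j < lam i → T0 i j = T0 c0.1 c0.2 → j ≤ c0.2)
    (hbw : List.Pairwise (fun a b : ℤ × ℕ => a.1 < b.1 ∨ (a.1 = b.1 ∧ a.2 ≤ b.2)) (om1 ++ [(t, x)]))
    (hrec : ∀ i, recRow [] (om1 ++ [(t, x)]) i = (List.range (lam i)).map (T0 i)) :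
    c0.2 + 1 = lam c0.1 ∧
    insertRowIdx ((om1.map Prod.snd).foldl insertTab []) x = c0.1 + 1 := by
  have hc : c0.2 + 1 = lam c0.1 := by
    have h1 := hT0row c0.1 c0.2 (lam c0.1 - 1) (by omega) (by omega)
    have h2 := hmax c0.1 (lam c0.1 - 1) (by omega)
    have := hright c0.1 (lam c0.1 - 1) (by omega) (le_antisymm h2 h1)
    omega
  refine ⟨hc, ?_⟩
  set P0 := (om1.map Prod.snd).foldl insertTab [] with hP0
  have hrec' : ∀ i, recRow [] om1 i ++ (if insertRowIdx P0 x = i + 1 then [t] else []) =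
      (List.range (lam i)).map (T0 i) := by
    intro i
    rw [← hrec i, recRow_append]
    simp [recRow, hP0]
  have hp := insertRowIdx_pos P0 x
  obtain ⟨R, hR⟩ : ∃ R, insertRowIdx P0 x = R + 1 := ⟨insertRowIdx P0 x - 1, by omega⟩
  have hRr := hrec' R
  rw [if_pos hR] at hRr
  have hlen := congrArg List.length hRr
  simp at hlen
  have htR : T0 R (lam R - 1) = t := by
    have h1 : ((List.range (lam R)).map (T0 R))[lam R - 1]? = some t := by
      rw [← hRr, List.getElem?_append_right (by omega)]
      rw [show lam R - 1 - (recRow [] om1 R).length = 0 by omega]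
      rfl
    rw [List.getElem?_map, List.getElem?_range (by omega)] at h1
    simpa using h1
  rw [List.pairwise_append] at hbw
  have hle : ∀ e ∈ om1, e.1 ≤ t := by
    intro e he
    have := hbw.2.2 e he (t, x) (by simp)
    simp only at this
    omega
  have hmem : T0 c0.1 c0.2 ∈ recRow [] om1 c0.1 ++ (if insertRowIdx P0 x = c0.1 + 1 then [t] else []) := by
    rw [hrec']
    exact List.mem_map.2 ⟨c0.2, by simpa using hc0, rfl⟩
  have ht : T0 c0.1 c0.2 = t := by
    apply le_antisymm
    · rcases List.mem_append.1 hmem with h | h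
      · obtain ⟨y, hy⟩ := recRow_mem _ _ _ _ h
        exact hle _ hy
      · split_ifs at h <;> simp at h
        exact h.le
    · rw [← htR]; exact hmax _ _ (by omega)
  by_contra hne
  rw [if_neg hne, List.append_nil, ht] at hmem
  obtain ⟨β1, y, β2, e1, e2⟩ := recRow_find _ _ _ _ hmem
  have hb1 := hbw.1
  rw [e1, List.pairwise_append, List.pairwise_cons] at hb1
  have htop : ∀ e ∈ β2, e.1 = t := by
    intro e he
    have h1 := hle e (by rw [e1]; simp [he])
    have h2 := hb1.2.1.1 e he
    simp only at h2
    omega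
  have hsrt : Srt (y :: (β2.map Prod.snd ++ [x])) := by
    rw [Srt, List.pairwise_cons, List.pairwise_append, List.pairwise_map]
    refine ⟨?_, ?_, by simp, ?_⟩
    · intro b hb
      rcases List.mem_append.1 hb with h | h
      · obtain ⟨e, he, rfl⟩ := List.mem_map.1 h
        have h2 := hb1.2.1.1 e he
        have := htop e he
        simp only at h2
        omega
      · simp at h
        subst h
        have := hbw.2.2 (t, y) (by rw [e1]; simp) (t, b) (by simp)
        simpa using this
    · refine List.Pairwise.imp_of_mem ?_ hb1.2.1.2
      intro a b ha hb h
      have := htop a ha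
      have := htop b hb
      omega
    · intro a ha b hb
      obtain ⟨e, he, rfl⟩ := List.mem_map.1 ha
      simp at hb
      subst hb
      have := htop e he
      have := hbw.2.2 e (by rw [e1]; simp [he]) (t, b) (by simp)
      simp only at this
      omega
  have htie := rowIdx_tie' (β2.map Prod.snd) ((β1.map Prod.snd).foldl insertTab []) y x
    (foldl_srt _ _ (by simp [RowsSrt])) hsrt
  rw [e2] at htie
  have : List.foldl insertTab (insertTab (List.foldl insertTab [] (β1.map Prod.snd)) y)
      (β2.map Prod.snd) = P0 := by
    rw [hP0, e1]; simp
  rw [this, hR] at htie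
  have h1 := hlam R c0.1 (by omega)
  have h2 := hright R (lam R - 1) (by omega) (by rw [htR, ht])
  have h3 : lam R - 1 = c0.2 := by omega
  rw [h3] at htR
  have := hT0col R c0.1 c0.2 (by omega) hc0
  omega

theorem Y_lf (nu : ℕ → ℕ) (hnu : ∀ i j, i ≤ j → nu j ≤ nu i) (L x : ℕ) (hx : 1 ≤ x) :
    wordP (lf x) ((List.range L).map fun i => List.replicate (nu i) (i + 1)) (some 0) ≠ none := by
  rw [wordP_rows, lf_rows]
  · simp
  · intro i; simp [Srt, List.pairwise_replicate]
  · intro i _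
    simp only [List.count_replicate]
    rw [Finset.sum_range_succ']
    have h0 : (if (0 + 1 == x + 1) = true then nu 0 else 0) = 0 := by
      rw [if_neg]; simp; omega
    rw [h0, add_zero]
    apply Finset.sum_le_sum
    intro j _
    simp only [beq_iff_eq, Nat.add_right_cancel_iff]
    split_ifs
    · exact hnu _ _ (by omega)
    · rfl
/-- **Theorem (demotion–RSK relationship).**
Let `S` be a ballot semistandard skew tableau of shape `ν/λ` and content `μ`,
`T₀` a semistandard tableau of shape `λ` with negative entries, and `c₀` the
box of the largest (rightmost if repeated) entry of `T₀`.  If `ω` is the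
biword with `RSK(ω) = (Y_ν, T₀ ∪ S)`, i.e. `ω = RSK⁻¹(Y_ν, T₀ ∪ S)`, then
`demote(c₀) = x_n`, the `n`-th bottom letter of `ω`, where `n = |λ|`. -/
theorem stmt13 (lam mu nu : ℕ → ℕ) (S : ℕ → ℕ → ℕ) (T0 : ℕ → ℕ → ℤ)
    (c0 : ℕ × ℕ) (L : ℕ) (om : List (ℤ × ℕ))
    (hS : IsLRTableau lam mu nu S)
    (hT0neg : ∀ i j, j < lam i → T0 i j < 0)
    (hT0row : ∀ i j j', j ≤ j' → j' < lam i → T0 i j ≤ T0 i j')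
    (hT0col : ∀ i i' j, i < i' → j < lam i' → T0 i j < T0 i' j)
    (hc0 : c0.2 < lam c0.1)
    (hmax : ∀ i j, j < lam i → T0 i j ≤ T0 c0.1 c0.2)
    (hright : ∀ i j, j < lam i → T0 i j = T0 c0.1 c0.2 → j ≤ c0.2)
    (hL : ∀ i, nu i = 0 ↔ L ≤ i)
    (hbw : List.Pairwise (fun a b : ℤ × ℕ => a.1 < b.1 ∨ (a.1 = b.1 ∧ a.2 ≤ b.2)) om)
    (hpos : ∀ e ∈ om, 0 < e.2)
    (hRSK : RSKpair om =
      ((List.range L).map fun i => List.replicate (nu i) (i + 1),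
       (List.range L).map fun i =>
         (List.range (nu i)).map fun j => if j < lam i then T0 i j else (S i j : ℤ))) :
    IsDemotion lam nu S c0 ((om.getD ((∑ᶠ i, lam i) - 1) ((0 : ℤ), (0 : ℕ))).2) := by
  obtain ⟨⟨hlam, _⟩, _, ⟨hnu, _⟩, hle, hz, hSpos, hrow, hcol, _, _⟩ := id hS
  have hF := RSK_fold om [] [] rfl
  have hRSK' : om.foldl RSKstep ([], []) = _ := hRSK
  rw [hRSK'] at hF
  obtain ⟨hP, hQ⟩ := hF
  simp only at hP hQ
  have hnu0 : ∀ i, L ≤ i → nu i = 0 := fun i h => (hL i).2 h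
  have hQ' : ∀ i, recRow [] om i = (List.range (lam i)).map (T0 i) ++
      (Srow lam nu S i).map (fun a : ℕ => (a : ℤ)) := by
    intro i
    have h1 := hQ i
    simp only [List.getD_nil, List.nil_append] at h1
    rw [← h1]
    have h2 : (List.range (nu i)).map (fun j => if j < lam i then T0 i j else (S i j : ℤ)) =
        (List.range (lam i)).map (T0 i) ++ (Srow lam nu S i).map (fun a : ℕ => (a : ℤ)) := by
      have h3 : nu i = lam i + (nu i - lam i) := by have := hle i; omega
      conv_lhs => rw [h3]
      rw [List.range_add, List.map_append, Srow, List.map_map, List.map_map]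
      congr 1
      · apply List.map_congr_left
        intro j hj
        simp at hj
        simp [hj]
      · apply List.map_congr_left
        intro j hj
        simp
    rw [← h2]
    by_cases hi : i < L
    · simp [List.getD, hi]
    · have := hnu0 i (by omega)
      simp [List.getD, hi, this]
  -- splitting
  have hsp := srt_split _ (fun e : ℤ × ℕ => decide (0 ≤ e.1))
    (by intro a b h1 h2; simp at *; omega) om hbw
  set om1 := om.filter (fun e : ℤ × ℕ => !decide (0 ≤ e.1)) with hom1
  set om2 := om.filter (fun e : ℤ × ℕ => decide (0 ≤ e.1)) with hom2
  have hn1 : ∀ e ∈ om1, e.1 < 0 := by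
    intro e he; rw [hom1] at he; simp at he; exact he.2
  have hn2 : ∀ e ∈ om2, 0 ≤ e.1 := by
    intro e he; rw [hom2] at he; simp at he; exact he.2
  clear_value om1 om2
  set P1 := (om1.map Prod.snd).foldl insertTab [] with hP1
  have hsplit : ∀ i, recRow [] om1 i = (List.range (lam i)).map (T0 i) ∧
      recRow P1 om2 i = (Srow lam nu S i).map (fun a : ℕ => (a : ℤ)) := by
    intro i
    have h1 := hQ' i
    rw [hsp, recRow_append] at h1
    refine app_split (fun a : ℤ => decide (a < 0)) _ _ _ _ h1 ?_ ?_ ?_ ?_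
    · intro a ha
      obtain ⟨y, hy⟩ := recRow_mem _ _ _ _ ha
      simpa using hn1 _ hy
    · intro a ha
      obtain ⟨y, hy⟩ := recRow_mem _ _ _ _ ha
      simpa using hn2 _ hy
    · intro a ha
      obtain ⟨j, hj, rfl⟩ := List.mem_map.1 ha
      simpa using hT0neg i j (by simpa using hj)
    · intro a ha
      obtain ⟨j, hj, rfl⟩ := List.mem_map.1 ha
      simp
  have hlam0 : ∀ i, L ≤ i → lam i = 0 := fun i h => by
    have := hle i; have := hnu0 i h; omega
  have hlen : om1.length = ∑ᶠ i, lam i := by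
    rw [← recRow_length L om1 [] (by intro i hi; rw [(hsplit i).1, hlam0 i hi]; rfl),
      finsum_eq_sum_of_support_subset (s := Finset.range L)]
    · apply Finset.sum_congr rfl
      intro i _
      rw [(hsplit i).1]; simp
    · intro i hi
      by_contra hc
      apply hi
      apply hlam0
      simpa using hc
  have hne : om1 ≠ [] := by
    rintro rfl
    have := (hsplit c0.1).1
    simp [recRow] at this
    omega
  obtain ⟨om1', ⟨t, x⟩, rfl⟩ : ∃ l a, om1 = l ++ [a] :=
    ⟨_, _, (List.dropLast_append_getLast hne).symm⟩
  have hget : om.getD ((∑ᶠ i, lam i) - 1) ((0 : ℤ), (0 : ℕ)) = (t, x) := by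
    rw [← hlen, hsp]
    simp [List.getD]
  rw [hget]
  simp only
  have hbs := hbw
  rw [hsp, List.pairwise_append] at hbs
  obtain ⟨hcc, hidx⟩ := last_idx lam T0 c0 om1' t x hlam hT0row hT0col hc0 hmax hright hbs.1
    (fun i => (hsplit i).1)
  set P0 := (om1'.map Prod.snd).foldl insertTab [] with hP0
  have hP10 : P1 = insertTab P0 x := by rw [hP1, hP0]; simp
  have hx : 0 < x := hpos (t, x) (by rw [hsp]; simp)
  have hSr : ∀ i, Srt (Srow lam nu S i) := by
    intro i
    rw [Srt, Srow, List.pairwise_map]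
    refine List.Pairwise.imp_of_mem ?_ (List.pairwise_lt_range (n := nu i - lam i))
    intro a b ha hb hab
    simp at ha hb
    exact hrow i _ _ ⟨by omega, by omega⟩ ⟨by omega, by omega⟩ (by omega)
  have hSrow0 : ∀ i, L ≤ i → Srow lam nu S i = [] := by
    intro i hi; simp [Srow, hnu0 i hi]
  -- tops of om2
  have htop2 : ∀ e ∈ om2, 1 ≤ e.1 := by
    intro e he
    obtain ⟨i, hi⟩ := recRow_top om2 P1 e he
    rw [(hsplit i).2] at hi
    obtain ⟨k, hk, hk2⟩ := List.mem_map.1 hi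
    rw [Srow, mem_Srow] at hk
    obtain ⟨j, hj, rfl⟩ := hk
    have := hSpos i j hj
    omega
  obtain ⟨B, hB⟩ : ∃ B, ∀ e ∈ om, e.2 < B := by
    refine ⟨(om.map Prod.snd).sum + 1, fun e he => ?_⟩
    have := List.single_le_sum (l := om.map Prod.snd) (by simp) e.2 (List.mem_map_of_mem he)
    omega
  set β2 : List (ℕ × ℕ) := om2.map (fun e => (e.1.toNat, e.2)) with hβ2
  have hβrec : ∀ i, recRow P1 β2 i = Srow lam nu S i := by
    intro i
    rw [hβ2, recRow_map, (hsplit i).2, List.map_map]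
    simp [Function.comp_def]
  have hβsnd : β2.map Prod.snd = om2.map Prod.snd := by
    rw [hβ2, List.map_map]; rfl
  have hβs : BSrt β2 := by
    rw [BSrt, hβ2, List.pairwise_map]
    refine List.Pairwise.imp_of_mem ?_ hbs.2.1
    intro a b ha hb h
    have := htop2 a ha
    have := htop2 b hb
    simp only
    omega
  have hβ1 : ∀ e ∈ β2, 1 ≤ e.1 ∧ 1 ≤ e.2 ∧ e.2 < B := by
    intro e he
    obtain ⟨e', he', rfl⟩ := List.mem_map.1 he
    have h1 := htop2 e' he'
    have hm : e' ∈ om := by rw [hsp]; exact List.mem_append_right _ he'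
    have h2 := hpos e' hm
    have h3 := hB e' hm
    simp only
    omega
  have hxB : x < B := hB (t, x) (by rw [hsp]; simp)
  have hP0s : RowsSrt P0 := foldl_srt _ _ (by simp [RowsSrt])
  have hP1s : RowsSrt P1 := foldl_srt _ _ (by simp [RowsSrt])
  have hP0B : ∀ r ∈ P0, ∀ a ∈ r, a < B := by
    apply foldl_bound B _ [] _ (by simp)
    intro a ha
    obtain ⟨e, he, rfl⟩ := List.mem_map.1 ha
    exact hB e (by rw [hsp]; simp [he])
  have hP1B : ∀ r ∈ P1, ∀ a ∈ r, a < B := by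
    rw [hP10]; exact insertTab_bound B P0 x hxB hP0B
  have hw : ∀ y, 1 ≤ y → pw (lf y) (x :: β2.map Prod.snd) (some 0) ≠ none := by
    intro y hy
    have h1 := Y_lf nu hnu L y hy
    rw [hP, wordP_foldl (lf_Kn y) _ _ (by simp [RowsSrt]), wordP, one_mul, hsp] at h1
    rw [hβsnd]
    refine (lf_suffix y (om1'.map Prod.snd) _ ?_).2
    simpa using h1
  have hu : ∀ y, 1 ≤ y → pw (lf y) (uw B β2) (some 0) ≠ none := by
    intro y hy
    rw [main_Q (lf_Kn y) B L P1 β2 hP1s hβs hP1B (fun e he => (hβ1 e he).2.2)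
      (fun i hi => by rw [hβrec, hSrow0 i hi])]
    rw [show recRow P1 β2 = Srow lam nu S from funext hβrec, lf_rows y _ hSr L]
    · simp
    · intro i _
      obtain ⟨k, rfl⟩ : ∃ k, y = k + 1 := ⟨y - 1, by omega⟩
      exact ballot_counts hS k i
  have hfin := fold_uw β2 x B hβs hβ1 hx hxB hw hu
  have hβrec0 : recRow P0 ((0, x) :: β2) = Rrow lam nu S c0 := by
    funext i
    rw [recRow]
    simp only
    rw [← hP10, hβrec, hidx, Rrow, ← Srow]
    by_cases h : i = c0.1
    · subst h; simp
    · rw [if_neg (by omega), if_neg h]; simp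
  have hL0 : c0.1 < L := by
    by_contra hc
    have := hlam0 c0.1 (by omega)
    omega
  have hβs0 : BSrt ((0, x) :: β2) := by
    rw [BSrt, List.pairwise_cons]
    refine ⟨fun e he => Or.inl ?_, hβs⟩
    exact (hβ1 e he).1
  rw [main_Q df_Kn B L P0 _ hP0s hβs0 hP0B
    (by
      intro e he
      rcases List.mem_cons.1 he with rfl | he
      · exact hxB
      · exact (hβ1 e he).2.2)
    (by
      intro i hi
      rw [hβrec0, Rrow, ← Srow, hSrow0 i hi, if_neg (by omega)]; rfl), hβrec0, df_rows] at hfin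
  · exact demo_of_rows lam nu S c0 x L hlam hnu hSpos hrow hcol hcc hnu0 hx hfin
  · intro i
    rw [Rrow, ← Srow]
    split_ifs
    · rw [Srt, List.singleton_append, List.pairwise_cons]
      exact ⟨fun _ _ => Nat.zero_le _, hSr i⟩
    · exact hSr i
end

section
/- Let S be a ballot semistandard skew tableau of shape ν/λ and content μ, and let c_0 be the corner box of λ lying in its southmost (last nonempty) row. If demotion is applied to S at c_0, then demote(c_0) = m, where m is the smallest positive integer that does not appear in the first column of S. -/
/-- Columns visited by demotion at the southmost corner. -/
noncomputable def demCol (lam nu : ℕ → ℕ) (S : ℕ → ℕ → ℕ) (L : ℕ) : ℕ → ℕ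
  | 0 => lam (L - 1) - 1
  | k + 1 => by
      classical
      exact Nat.findGreatest (fun j => InSkew lam nu (L + k) j ∧ S (L + k) j = k + 1)
        (demCol lam nu S L k)

/-- **Claim (demotion at the southmost corner).**
If `S` is a ballot semistandard skew tableau of shape `ν/λ` and content `μ`,
and `c₀` is the corner box of `λ` in its southmost (last nonempty) row `L`,
then `demote(c₀) = m`, the smallest positive integer not appearing in the
first column of `S`. -/
theorem stmt17 (lam mu nu : ℕ → ℕ) (S : ℕ → ℕ → ℕ) (L : ℕ)
    (hS : IsLRTableau lam mu nu S)
    (hL : ∀ i, lam i = 0 ↔ L ≤ i) (hL0 : 0 < L) :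
    IsDemotion lam nu S (L - 1, lam (L - 1) - 1)
      (sInf {m : ℕ | 0 < m ∧ ∀ i, InSkew lam nu i 0 → S i 0 ≠ m}) := by
  classical
  obtain ⟨hlam, -, hnu, -, -, hpos, hrow, hcol, -, -⟩ := hS
  set A := {m : ℕ | 0 < m ∧ ∀ i, InSkew lam nu i 0 → S i 0 ≠ m} with hA
  have hlam0 : ∀ i, L ≤ i → lam i = 0 := fun i hi => (hL i).2 hi
  have hlamp : 0 < lam (L - 1) := by
    rcases Nat.eq_zero_or_pos (lam (L - 1)) with h | h
    · have := (hL _).1 h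
      omega
    · exact h
  -- nonemptiness
  have hne : A.Nonempty := by
    obtain ⟨N, hN⟩ := hnu.2
    have hfin : ((fun i => S i 0) '' (Set.Iio N)).Finite := (Set.finite_Iio N).image _
    obtain ⟨b, hb⟩ := hfin.bddAbove
    refine ⟨b + 1, by omega, fun i hi he => ?_⟩
    have hiN : i < N := by
      by_contra h
      have := hN i (by omega)
      have := hi.2
      omega
    have : S i 0 ≤ b := hb ⟨i, hiN, rfl⟩
    omega
  obtain ⟨m, hm⟩ : ∃ m, m = sInf A := ⟨_, rfl⟩
  rw [← hm]
  have hmem : m ∈ A := hm ▸ Nat.sInf_mem hne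
  have hlt : ∀ k, 0 < k → k < m → ∃ i, InSkew lam nu i 0 ∧ S i 0 = k := by
    intro k hk hkm
    by_contra h
    push Not at h
    exact Nat.notMem_of_lt_sInf (s := A) (by omega) ⟨hk, h⟩
  -- entries below row L are large
  have hlow : ∀ r j, InSkew lam nu (L + r) j → r + 1 ≤ S (L + r) j := by
    intro r
    induction r with
    | zero => intro j hj; exact hpos _ _ hj
    | succ r ih =>
      intro j hj
      have h2 : InSkew lam nu (L + r) j :=
        ⟨by rw [hlam0 _ (by omega)]; omega, lt_of_lt_of_le hj.2 (hnu.1 _ _ (by omega))⟩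
      have := ih j h2
      have := hcol _ _ _ h2 hj (by omega)
      omega
  have hrowL : ∀ i j, InSkew lam nu i j → j < lam (L - 1) → L ≤ i := by
    intro i j hij hj
    by_contra h
    have := hlam.1 i (L - 1) (by omega)
    have := hij.1
    omega
  -- candidates lie in the expected row
  have hcand : ∀ k jk i j, jk < lam (L - 1) →
      (k = 0 ∨ (InSkew lam nu (L + k - 1) jk ∧ S (L + k - 1) jk = k)) →
      InSkew lam nu i j → S i j = k + 1 → j ≤ jk → i = L + k := by
    intro k jk i j hjk hk hij hs hj
    have h1 := hrowL i j hij (by omega)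
    obtain ⟨r, rfl⟩ := Nat.exists_eq_add_of_le h1
    have h2 := hlow r j hij
    by_contra hne'
    rcases hk with rfl | ⟨hk1, hk2⟩
    · omega
    · have h3 : InSkew lam nu (L + k - 1) j :=
        ⟨by rw [hlam0 _ (by omega)]; omega, lt_of_le_of_lt hj hk1.2⟩
      have h4 := hrow _ _ _ h3 hk1 hj
      rcases Nat.lt_or_ge (L + r) (L + k - 1) with h5 | h5
      · have := hcol _ _ _ hij h3 h5
        omega
      · have h6 : L + r = L + k - 1 := by omega
        rw [h6] at hs
        omega
  have hinv : ∀ k, k < m → demCol lam nu S L k < lam (L - 1) ∧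
      (k = 0 ∨ (InSkew lam nu (L + k - 1) (demCol lam nu S L k) ∧
        S (L + k - 1) (demCol lam nu S L k) = k)) := by
    intro k
    induction k with
    | zero => intro _; exact ⟨by simp only [demCol]; omega, Or.inl rfl⟩
    | succ k ih =>
      intro hk
      obtain ⟨h1, h2⟩ := ih (by omega)
      obtain ⟨i, hi, hs⟩ := hlt (k + 1) (by omega) hk
      have hi' := hcand k _ i 0 h1 h2 hi hs (Nat.zero_le _)
      subst hi'
      have h3 := Nat.findGreatest_spec
        (P := fun j => InSkew lam nu (L + k) j ∧ S (L + k) j = k + 1)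
        (Nat.zero_le (demCol lam nu S L k)) ⟨hi, hs⟩
      have h4 := Nat.findGreatest_le
        (P := fun j => InSkew lam nu (L + k) j ∧ S (L + k) j = k + 1)
        (demCol lam nu S L k)
      refine ⟨lt_of_le_of_lt h4 h1, Or.inr ?_⟩
      exact h3
  refine ⟨hmem.1, fun k => (L + k - 1, demCol lam nu S L k), rfl, ?_, ?_⟩
  · intro k hk0 hk
    obtain ⟨k, rfl⟩ : ∃ l, k = l + 1 := ⟨k - 1, by omega⟩
    obtain ⟨h1, h2⟩ := hinv k (by omega)
    obtain ⟨h3, h4⟩ := hinv (k + 1) hk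
    have h4 := h4.resolve_left (by omega)
    have h5 : demCol lam nu S L (k + 1) ≤ demCol lam nu S L k :=
      Nat.findGreatest_le (P := fun j => InSkew lam nu (L + k) j ∧ S (L + k) j = k + 1) _
    refine ⟨h4.1, h4.2, ?_, ?_⟩
    · simp only [ColOrder, Nat.add_sub_cancel]
      omega
    · rintro ⟨i, j⟩ hp hs hc hc2
      simp only [ColOrder, Nat.add_sub_cancel] at hp hs hc hc2
      have h6 := hcand k _ i j h1 h2 hp hs (by omega)
      subst h6
      have h7 : j ≤ demCol lam nu S L (k + 1) :=
        Nat.le_findGreatest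
          (P := fun j => InSkew lam nu (L + k) j ∧ S (L + k) j = k + 1) (by omega) ⟨hp, hs⟩
      omega
  · rintro ⟨i, j⟩ hp hs hc
    obtain ⟨k, rfl⟩ : ∃ l, m = l + 1 := ⟨m - 1, by have := hmem.1; omega⟩
    obtain ⟨h1, h2⟩ := hinv k (by omega)
    simp only [ColOrder, Nat.add_sub_cancel] at hp hs hc
    have h6 := hcand k _ i j h1 h2 hp hs (by omega)
    subst h6
    have h7 : InSkew lam nu (L + k) 0 := ⟨by rw [hlam0 _ (by omega)], by have := hp.2; omega⟩
    have h8 := hrow _ _ _ h7 hp (Nat.zero_le _)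
    have h9 := hlow _ _ h7
    exact hmem.2 _ h7 (by omega)
end

section
/- Let λ ⊆ ν be partitions and label the boxes of the southmost (last nonempty) row of λ by d_1,…,d_i from right to left. Let U_1 = U be a ballot semistandard skew tableau of shape ν/λ, and for j > 1 let U_j be the tableau resulting from applying demotion to U_{j−1} at the corner d_{j−1}; let demote(d_j) be computed by applying demotion to U_j at d_j. Then demote(d_1) ≥ demote(d_2) ≥ … ≥ demote(d_i). -/
theorem demote_pair_le (lam1 lam2 nu : ℕ → ℕ) (S S1 : ℕ → ℕ → ℕ) (m m' : ℕ) (c c' : ℕ → ℕ × ℕ)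
    (hm : 0 < m)
    (hsk : ∀ p : ℕ × ℕ, InSkew lam2 nu p.1 p.2 → p ≠ c 0 → InSkew lam1 nu p.1 p.2)
    (h0 : ColOrder (c 0) (c' 0))
    (hw : DemotionWitness lam1 nu S m c)
    (hS1 : ∀ k, k < m → S1 (c k).1 (c k).2 = k + 1)
    (hS2 : ∀ p : ℕ × ℕ, (∀ k, k < m → p ≠ c k) → S1 p.1 p.2 = S p.1 p.2)
    (hw' : DemotionWitness lam2 nu S1 m' c') : m' ≤ m := by
  have tr : ∀ p q r : ℕ × ℕ, ColOrder p q → ColOrder q r → ColOrder p r := by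
    intro p q r; unfold ColOrder; omega
  have irr : ∀ p : ℕ × ℕ, ¬ ColOrder p p := by
    intro p; unfold ColOrder; omega
  have tot : ∀ p q : ℕ × ℕ, p ≠ q → ¬ ColOrder p q → ColOrder q p := by
    rintro ⟨a, b⟩ ⟨a', b'⟩ h; unfold ColOrder
    simp only [ne_eq, Prod.mk.injEq] at h ⊢
    omega
  -- a box that is `k` in the new tableau and after `c (k-1)` was `k` in the old one
  have key : ∀ k, 0 < k → k ≤ m → ∀ p : ℕ × ℕ, InSkew lam2 nu p.1 p.2 → S1 p.1 p.2 = k →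
      ColOrder (c (k - 1)) p →
      InSkew lam1 nu p.1 p.2 ∧ S p.1 p.2 = k ∧ ∀ i, i < m → p ≠ c i := by
    intro k hk hkm p hp hpk hc
    have hne : ∀ i, i < m → p ≠ c i := by
      rintro i hi rfl
      have h1 := hS1 i hi
      have : i = k - 1 := by omega
      subst this
      exact irr _ hc
    exact ⟨hsk p hp (hne 0 hm), by rw [← hS2 p hne]; exact hpk, hne⟩
  have main : ∀ k, k < m → k < m' → ColOrder (c k) (c' k) := by
    intro k
    induction k with
    | zero => intro _ _; exact h0
    | succ k ih =>
      intro hk hk'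
      have h1 := ih (by omega) (by omega)
      obtain ⟨a1, a2, a3, -⟩ := hw'.1 (k + 1) (by omega) hk'
      obtain ⟨-, -, -, b4⟩ := hw.1 (k + 1) (by omega) hk
      simp only [Nat.add_sub_cancel] at a3 b4
      have h2 := tr _ _ _ h1 a3
      obtain ⟨e1, e2, e3⟩ := key (k + 1) (by omega) (by omega) (c' (k + 1)) a1 a2
        (by simpa using h2)
      exact tot _ _ (e3 _ hk) (b4 _ e1 e2 h2)
  by_contra hlt
  obtain ⟨a1, a2, a3, -⟩ := hw'.1 m hm (by omega)
  have h2 := tr _ _ _ (main (m - 1) (by omega) (by omega)) a3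
  obtain ⟨e1, e2, -⟩ := key m hm le_rfl (c' m) a1 a2 h2
  exact hw.2 _ e1 e2 h2

/-- **Claim (weak decrease of demotion outputs along the southmost row).**
Label the boxes of the southmost row of `λ` by `d_1,…,d_i` from right to
left, let `U_1 = U` be a ballot semistandard skew tableau of shape `ν/λ`, and
let `U_{j+1}` be the result of demotion applied to `U_j` at `d_j`, with
output `demote(d_j) = mseq j`.  Then
`demote(d_1) ≥ demote(d_2) ≥ … ≥ demote(d_i)`. -/
theorem stmt18 (lam mu nu : ℕ → ℕ) (U : ℕ → ℕ → ℕ) (L : ℕ)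
    (hU : IsLRTableau lam mu nu U)
    (hL : ∀ i, lam i = 0 ↔ L ≤ i) (hL0 : 0 < L)
    (Useq : ℕ → ℕ → ℕ → ℕ) (mseq : ℕ → ℕ)
    (hU1 : Useq 1 = U)
    (hstep : ∀ j, 1 ≤ j → j ≤ lam (L - 1) →
      IsDemotionPair (fun i => if i = L - 1 then lam (L - 1) - (j - 1) else lam i)
        nu (Useq j) (L - 1, lam (L - 1) - j) (mseq j) (Useq (j + 1))) :
    ∀ j j', 1 ≤ j → j ≤ j' → j' ≤ lam (L - 1) → mseq j' ≤ mseq j := by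
  have step : ∀ j, 1 ≤ j → j + 1 ≤ lam (L - 1) → mseq (j + 1) ≤ mseq j := by
    intro j hj hj'
    obtain ⟨hm, c, hc0, hw, h1, h2⟩ := hstep j hj (by omega)
    obtain ⟨-, c', hc0', hw', -, -⟩ := hstep (j + 1) (by omega) hj'
    refine demote_pair_le _ _ nu _ _ _ _ c c' hm ?_ ?_ hw h1 h2 hw'
    · rintro ⟨a, b⟩ hp hne
      rw [hc0] at hne
      simp only [InSkew, ne_eq, Prod.mk.injEq] at hp hne ⊢
      split_ifs at hp ⊢ with h
      · omega
      · exact hp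
    · rw [hc0, hc0']
      unfold ColOrder
      left
      show lam (L - 1) - (j + 1) < lam (L - 1) - j
      omega
  intro j j' hj hjj'
  induction j', hjj' using Nat.le_induction with
  | base => intro _; exact le_rfl
  | succ n hn ih =>
    intro h
    exact (step n (by omega) h).trans (ih (by omega))
end

section
/- Let w be a reverse-ballot word of positive integers, i.e., the reverse of w is a ballot (lattice) word. Then for every final segment f of w (a contiguous suffix), the RSK insertion tableau RSK_1(f) is super-semistandard, i.e., every entry in its row i equals i. -/
/-- A word is ballot (a lattice word) if in every initial segment each value
`i+2` occurs at most as often as `i+1`. -/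
def IsBallotWord (u : List ℕ) : Prop :=
  ∀ k i, ((u.take k).count (i + 2)) ≤ ((u.take k).count (i + 1))

def RY (m : ℕ) : List ℕ → Prop
  | [] => True
  | a :: w => RY m w ∧ ∀ i, m ≤ i → (a :: w).count (i + 1) ≤ (a :: w).count i

theorem RY.cnt {m : ℕ} {w : List ℕ} (h : RY m w) (i : ℕ) (hi : m ≤ i) :
    w.count (i + 1) ≤ w.count i := by
  cases w with
  | nil => simp
  | cons a w => exact h.2 i hi

theorem RY.drop {m : ℕ} (A : List ℕ) {w : List ℕ} (h : RY m (A ++ w)) : RY m w := by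
  induction A with
  | nil => exact h
  | cons a A ih => exact ih h.1

theorem RY.build {m : ℕ} (A : List ℕ) {w : List ℕ} (h : RY m w)
    (hA : ∀ A', A' <:+ A → ∀ i, m ≤ i → (A' ++ w).count (i + 1) ≤ (A' ++ w).count i) :
    RY m (A ++ w) := by
  induction A with
  | nil => exact h
  | cons a A ih =>
    exact ⟨ih (fun A' h' => hA A' (h'.trans (List.suffix_cons a A))), hA _ (List.suffix_refl _)⟩

theorem RY.suff {m : ℕ} {A A' w : List ℕ} (h : RY m (A ++ w)) (h' : A' <:+ A) :
    RY m (A' ++ w) := by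
  obtain ⟨t, rfl⟩ := h'
  rw [List.append_assoc] at h
  exact h.drop

theorem RY.step {m x y : ℕ} {P Q B : List ℕ} (hP : ∀ p ∈ P, p ≤ x) (hQ : ∀ q ∈ Q, y ≤ q)
    (hxy : x < y) (h : RY m ((P ++ y :: Q) ++ x :: B)) :
    RY m (y :: ((P ++ x :: Q) ++ B)) := by
  have c0 : ∀ (l : List ℕ) (i : ℕ), (∀ q ∈ l, q ≠ i) → l.count i = 0 := by
    intro l i hl
    exact List.count_eq_zero.2 (fun hi => hl i hi rfl)
  have hfull := h.cnt
  have h1 : RY m (P ++ (y :: (Q ++ x :: B))) := by simpa using h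
  have h2 : RY m (y :: (Q ++ x :: B)) := h1.drop
  have h3 : RY m (Q ++ x :: B) := h2.1
  have h4 : RY m (x :: B) := h3.drop
  have h5 : RY m B := h4.1
  have k1 : RY m (Q ++ B) := by
    refine RY.build Q h5 ?_
    intro Q' hQ' i hi
    have a1 := (h3.suff hQ').cnt i hi
    have a2 := h2.cnt i hi
    have a3 := h5.cnt i hi
    have a4 := hQ'.sublist.count_le (i + 1)
    have a5 : i < y → Q.count i = 0 := fun hh => c0 _ _ (fun q hq => by have := hQ q hq; omega)
    have a6 : i + 1 < y → Q.count (i + 1) = 0 :=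
      fun hh => c0 _ _ (fun q hq => by have := hQ q hq; omega)
    simp only [List.count_append, List.count_cons, beq_iff_eq] at *
    split_ifs at * <;> omega
  have k2 : RY m (x :: (Q ++ B)) := by
    refine ⟨k1, fun i hi => ?_⟩
    have a1 := h3.cnt i hi
    have a2 := h4.cnt i hi
    have a3 := k1.cnt i hi
    have a6 : i + 1 < y → Q.count (i + 1) = 0 :=
      fun hh => c0 _ _ (fun q hq => by have := hQ q hq; omega)
    simp only [List.count_append, List.count_cons, beq_iff_eq] at *
    split_ifs at * <;> omega
  have k3 : RY m (P ++ x :: (Q ++ B)) := by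
    refine RY.build P k2 ?_
    intro P' hP' i hi
    have a1 := (h1.suff hP').cnt i hi
    have a2 := k2.cnt i hi
    have a5 : x < i + 1 → P'.count (i + 1) = 0 :=
      fun hh => c0 _ _ (fun q hq => by have := hP q (hP'.subset hq); omega)
    simp only [List.count_append, List.count_cons, beq_iff_eq] at *
    split_ifs at * <;> omega
  refine ⟨by simpa using k3, fun i hi => ?_⟩
  have := hfull i hi
  simp only [List.count_append, List.count_cons] at *
  omega

theorem insertRow_cases (row : List ℕ) (x : ℕ) :
    ((∀ p ∈ row, p ≤ x) ∧ insertRow row x = (row ++ [x], none)) ∨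
    ∃ P y Q, row = P ++ y :: Q ∧ (∀ p ∈ P, p ≤ x) ∧ x < y ∧
      insertRow row x = (P ++ x :: Q, some y) := by
  induction row with
  | nil => left; simp [insertRow]
  | cons a r ih =>
    by_cases hax : a ≤ x
    · rcases ih with ⟨h1, h2⟩ | ⟨P, y, Q, h1, h2, h3, h4⟩
      · left
        refine ⟨by simpa [hax] using h1, by simp [insertRow, hax, h2]⟩
      · right
        exact ⟨a :: P, y, Q, by simp [h1], by simpa [hax] using h2, h3,
          by simp [insertRow, hax, h4]⟩
    · right
      exact ⟨[], a, r, rfl, by simp, by omega, by simp [insertRow, hax]⟩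

theorem run_row (m : ℕ) (f : List ℕ) : ∀ row : List ℕ, row.Pairwise (· ≤ ·) →
    (∀ a ∈ row, m ≤ a) → (∀ a ∈ f, m ≤ a) → RY m (row ++ f) →
    ∃ b r : List ℕ, r.Pairwise (· ≤ ·) ∧ (∀ a ∈ r, m ≤ a) ∧ (∀ a ∈ b, m + 1 ≤ a) ∧
      RY m (b ++ r) ∧ (∀ i, (b ++ r).count i = (row ++ f).count i) ∧
      ∀ rest, f.foldl insertTab (row :: rest) = r :: b.foldl insertTab rest := by
  induction f with
  | nil =>
    intro row h1 h2 h3 h4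
    exact ⟨[], row, h1, h2, by simp, by simpa using h4, by simp, by simp⟩
  | cons x f ih =>
    intro row h1 h2 h3 h4
    have hx : m ≤ x := h3 x (by simp)
    have hf : ∀ a ∈ f, m ≤ a := fun a ha => h3 a (by simp [ha])
    rcases insertRow_cases row x with ⟨g1, g2⟩ | ⟨P, y, Q, rfl, g2, g3, g4⟩
    · obtain ⟨b, r, e1, e2, e3, e4, e5, e6⟩ := ih (row ++ [x])
        (by
          rw [List.pairwise_append]
          exact ⟨h1, by simp, by simpa using g1⟩)
        (by
          intro a ha
          rcases List.mem_append.1 ha with ha | ha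
          · exact h2 a ha
          · simp at ha; omega) hf (by simpa using h4)
      refine ⟨b, r, e1, e2, e3, e4, fun i => by simpa using e5 i, fun rest => ?_⟩
      rw [List.foldl_cons, ← e6 rest]
      simp [insertTab, g2]
    · rw [List.pairwise_append, List.pairwise_cons] at h1
      obtain ⟨s1, ⟨s2, s3⟩, s4⟩ := h1
      have key := RY.step g2 s2 g3 h4
      obtain ⟨b, r, e1, e2, e3, e4, e5, e6⟩ := ih (P ++ x :: Q)
        (by
          rw [List.pairwise_append, List.pairwise_cons]
          refine ⟨s1, ⟨fun q hq => ?_, s3⟩, ?_⟩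
          · have := s2 q hq; omega
          · intro a ha c hc
            rcases List.mem_cons.1 hc with rfl | hc
            · exact g2 a ha
            · exact s4 a ha c (by simp [hc]))
        (by
          intro a ha
          simp only [List.mem_append, List.mem_cons] at ha
          rcases ha with ha | rfl | ha
          · exact h2 a (by simp [ha])
          · exact hx
          · exact h2 a (by simp [ha])) hf key.1
      refine ⟨y :: b, r, e1, e2, ?_, ⟨e4, fun i hi => ?_⟩, fun i => ?_, fun rest => ?_⟩
      · intro a ha
        rcases List.mem_cons.1 ha with rfl | ha
        · omega
        · exact e3 a ha
      · change (y :: (b ++ r)).count (i + 1) ≤ (y :: (b ++ r)).count i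
        have := key.cnt i hi
        have := e5 i
        have := e5 (i + 1)
        simp only [List.cons_append, List.count_cons, List.count_append] at *
        omega
      · have := e5 i
        simp only [List.cons_append, List.count_cons, List.count_append] at *
        omega
      · rw [List.foldl_cons, List.foldl_cons, ← e6]
        simp [insertTab, g4]

theorem row_const {m : ℕ} (r : List ℕ) (h1 : r.Pairwise (· ≤ ·)) (h2 : ∀ a ∈ r, m ≤ a)
    (h : RY m r) : ∀ a ∈ r, a = m := by
  induction r with
  | nil => simp
  | cons a r ih =>
    rw [List.pairwise_cons] at h1
    have ih' := ih h1.2 (fun c hc => h2 c (by simp [hc])) h.1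
    have ha := h2 a (by simp)
    have : a = m := by
      cases r with
      | nil =>
        by_contra hne
        have := h.2 (a - 1) (by omega)
        rw [Nat.sub_add_cancel (by omega)] at this
        have hz : a ≠ a - 1 := by omega
        simp [List.count_cons, hz] at this
      | cons c r =>
        have := h1.1 c (by simp)
        have := ih' c (by simp)
        omega
    intro c hc
    rcases List.mem_cons.1 hc with rfl | hc
    · exact this
    · exact ih' c hc

theorem RY.left {m : ℕ} {b r : List ℕ} (hr : ∀ a ∈ r, a = m) (h : RY m (b ++ r)) :
    RY (m + 1) b := by
  induction b with
  | nil => trivial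
  | cons a b ih =>
    refine ⟨ih h.1, fun i hi => ?_⟩
    have h1 := RY.cnt h i (by omega)
    have h2 : r.count i = 0 := List.count_eq_zero.2 (fun hc => by have := hr _ hc; omega)
    rw [List.count_append, List.count_append] at h1
    omega

theorem main_aux (i : ℕ) : ∀ (m : ℕ) (f : List ℕ), (∀ a ∈ f, m ≤ a) → RY m f →
    ∀ x ∈ (RSK1 f).getD i [], x = i + m := by
  induction i with
  | zero =>
    intro m f hf h x hx
    cases f with
    | nil => simp [RSK1] at hx
    | cons a f =>
      obtain ⟨b, r, e1, e2, e3, e4, e5, e6⟩ := run_row m f [a] (by simp)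
        (by simpa using hf a (by simp)) (fun c hc => hf c (by simp [hc])) h
      have : RSK1 (a :: f) = r :: RSK1 b := e6 []
      rw [this] at hx
      have := row_const r e1 e2 e4.drop x (by simpa using hx)
      omega
  | succ i ih =>
    intro m f hf h x hx
    cases f with
    | nil => simp [RSK1] at hx
    | cons a f =>
      obtain ⟨b, r, e1, e2, e3, e4, e5, e6⟩ := run_row m f [a] (by simp)
        (by simpa using hf a (by simp)) (fun c hc => hf c (by simp [hc])) h
      have : RSK1 (a :: f) = r :: RSK1 b := e6 []
      rw [this] at hx
      have := ih (m + 1) b e3 (e4.left (row_const r e1 e2 e4.drop)) x (by simpa using hx)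
      omega

theorem RY_of_ballot (w : List ℕ) (hb : IsBallotWord w.reverse) (f : List ℕ) (hf : f <:+ w) :
    RY 1 f := by
  induction f with
  | nil => trivial
  | cons a f ih =>
    refine ⟨ih ((List.suffix_cons a f).trans hf), fun i hi => ?_⟩
    have := hb (a :: f).length (i - 1)
    have e : w.reverse.take (a :: f).length = (a :: f).reverse := by
      have := List.prefix_iff_eq_take.1 (List.reverse_prefix.2 hf)
      rw [List.length_reverse] at this
      exact this.symm
    rw [e, List.count_reverse, List.count_reverse] at this
    have e1 : i - 1 + 2 = i + 1 := by omega
    have e2 : i - 1 + 1 = i := by omega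
    rwa [e1, e2] at this

/-- **Lemma.** If `w` is a reverse-ballot word (its reverse is a lattice
word), then for every final segment `f` of `w`, the RSK insertion tableau
`RSK₁(f)` is super-semistandard: every entry of its `i`-th row equals `i`. -/
theorem stmt19 (w : List ℕ) (hw : ∀ x ∈ w, 0 < x) (hb : IsBallotWord w.reverse) :
    ∀ f : List ℕ, f <:+ w → ∀ i, ∀ x ∈ (RSK1 f).getD i [], x = i + 1 := by
  intro f hf i x hx
  exact main_aux i 1 f (fun a ha => hw a (hf.subset ha)) (RY_of_ballot w hb f hf) x hx
end
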